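/- arXiv:2011.03220 — 2 statements merged into one kernel-verified Lean document; each statement's English description precedes it below -/
import Mathlib

section
/- Local interior Calderón–Zygmund estimate on Euclidean balls: for every n ≥ 1 and every 1 < p < ∞ there exists a constant C = C(n,p) > 0 such that for every function u that is smooth on the open ball B₂(0) ⊂ ℝⁿ one has ‖Hess u‖_{L^p(B₁(0))} ≤ C ( ‖u‖_{L^p(B₂(0))} + ‖Δu‖_{L^p(B₂(0))} ). -/
open MeasureTheory

/-- Partial derivative `∂ᵢ u` of a function on `ℝⁿ = EuclideanSpace ℝ (Fin n)`. -/
noncomputable def pd {n : ℕ} (u : EuclideanSpace ℝ (Fin n) → ℝ) (i : Fin n)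
    (x : EuclideanSpace ℝ (Fin n)) : ℝ :=
  fderiv ℝ u x (EuclideanSpace.single i 1)

/-- Second partial derivative `∂ᵢ∂ⱼ u`. -/
noncomputable def pd2 {n : ℕ} (u : EuclideanSpace ℝ (Fin n) → ℝ) (i j : Fin n)
    (x : EuclideanSpace ℝ (Fin n)) : ℝ :=
  pd (pd u j) i x

/-- Laplacian `Δu = ∑ᵢ ∂ᵢ² u`. -/
noncomputable def lap {n : ℕ} (u : EuclideanSpace ℝ (Fin n) → ℝ)
    (x : EuclideanSpace ℝ (Fin n)) : ℝ :=
  ∑ i : Fin n, pd2 u i i x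

/-- Euclidean norm of the gradient, `|∇u|(x) = (∑ᵢ (∂ᵢu)²)^{1/2}`. -/
noncomputable def gradNorm {n : ℕ} (u : EuclideanSpace ℝ (Fin n) → ℝ)
    (x : EuclideanSpace ℝ (Fin n)) : ℝ :=
  Real.sqrt (∑ i : Fin n, pd u i x ^ 2)

/-- Hilbert–Schmidt norm of the Hessian, `|Hess u|(x) = (∑_{i,j} (∂ᵢ∂ⱼu)²)^{1/2}`. -/
noncomputable def hessNorm {n : ℕ} (u : EuclideanSpace ℝ (Fin n) → ℝ)
    (x : EuclideanSpace ℝ (Fin n)) : ℝ :=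
  Real.sqrt (∑ i : Fin n, ∑ j : Fin n, pd2 u i j x ^ 2)

/-- `L^p` norm with respect to Lebesgue measure on `ℝⁿ`:  `(∫ |f|^p)^{1/p}`. -/
noncomputable def lpNorm {n : ℕ} (p : ℝ) (f : EuclideanSpace ℝ (Fin n) → ℝ) : ℝ :=
  (∫ x, |f x| ^ p) ^ (1 / p)

set_option maxHeartbeats 1000000 in
/-- core algebraic inequality -/
lemma cz_alg (p q θ K x y h k X Y P R W σ : ℝ) (hp : 2 ≤ p) (hq : 1 < q) (hq2 : q ≤ 2)
    (hθ : θ = 1 - 2 / p) (hX : 0 < X) (hY : 0 < Y) (hP : 0 < P) (hR : 0 < R) (hW : 0 < W)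
    (hxX : x ^ 2 ≤ X) (hyY : y ^ 2 ≤ Y) (hXW : X * W ≤ P + R) (hWR : Y ≤ W * R)
    (hσ : σ ^ 2 ≤ 1) (hK : 8 * q ^ 2 + 1 ≤ K * (q * (q - 1))) (hK0 : 0 ≤ K) :
    0 ≤ 2 * h ^ 2 * W + 4 * θ * x * h * ((p * x * h * (P / X) + q * y * k * (R / Y)) * (W / (P + R)))
      - 2 / p * θ * X * (W / (P + R) ^ 2) * (p * x * h * (P / X) + q * y * k * (R / Y)) ^ 2
      + θ * X * (W / (P + R)) * ((p * h ^ 2 * (P / X) + p * (p - 2) * x ^ 2 * h ^ 2 * (P / X ^ 2))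
          + (q * k ^ 2 * (R / Y) + q * (q - 2) * y ^ 2 * k ^ 2 * (R / Y ^ 2)))
      + K * (q * k ^ 2 * (R / Y) + q * (q - 2) * y ^ 2 * k ^ 2 * (R / Y ^ 2)) + 2 * σ * h * k := by
  have hp0 : 0 < p := by linarith
  have hθ0 : 0 ≤ θ := by
    rw [hθ]; have : 2 / p ≤ 1 := by rw [div_le_one hp0]; exact hp
    linarith
  have h2p : 0 ≤ 2 / p := by positivity
  have h2p1 : 2 / p ≤ 1 := by rw [div_le_one hp0]; exact hp
  have hθ1 : θ ≤ 1 := by rw [hθ]; linarith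
  set M := P + R with hM
  have hM0 : 0 < M := by positivity
  set c := R / Y with hc
  have hc0 : 0 < c := by positivity
  have hRY : R = c * Y := by rw [hc]; field_simp
  set w := W / M with hw
  have hw0 : 0 < w := by positivity
  have hWw : W = w * M := by rw [hw]; field_simp
  have hXw : X * w ≤ 1 := by rw [hw, ← mul_div_assoc, div_le_one hM0]; exact hXW
  set b := P / X with hb
  have hb0 : 0 < b := by positivity
  have hPX : P = b * X := by rw [hb]; field_simp
  have e1 : W / M ^ 2 = w / M := by rw [hw]; field_simp
  have e2 : P / X ^ 2 = b / X := by rw [hb]; field_simp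
  have e3 : R / Y ^ 2 = c / Y := by rw [hc]; field_simp
  rw [e1, e2, e3]
  -- R'' lower bound
  have hR2 : q * (q - 1) * k ^ 2 * c ≤ q * k ^ 2 * c + q * (q - 2) * y ^ 2 * k ^ 2 * (c / Y) := by
    have : y ^ 2 / Y ≤ 1 := by rw [div_le_one hY]; exact hyY
    have h1 : q * (q - 2) * y ^ 2 * k ^ 2 * (c / Y) = -(q * (2 - q) * k ^ 2 * c) * (y ^ 2 / Y) := by ring
    have h2 : 0 ≤ q * (2 - q) * k ^ 2 * c := by
      have : 0 ≤ 2 - q := by linarith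
      positivity
    have h3 := mul_le_of_le_one_right h2 this
    rw [h1]; linarith
  have hR2' : 0 ≤ q * (q - 1) * k ^ 2 * c := by
    have : 0 ≤ q - 1 := by linarith
    positivity
  have hP2 : 0 ≤ p * h ^ 2 * b + p * (p - 2) * x ^ 2 * h ^ 2 * (b / X) := by
    have : 0 ≤ p - 2 := by linarith
    positivity
  have t4 : 0 ≤ θ * X * w * ((p * h ^ 2 * b + p * (p - 2) * x ^ 2 * h ^ 2 * (b / X))
          + (q * k ^ 2 * c + q * (q - 2) * y ^ 2 * k ^ 2 * (c / Y))) := by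
    apply mul_nonneg (by positivity); linarith
  have t5 : (8 * q ^ 2 + 1) * (k ^ 2 * c) ≤ K * (q * k ^ 2 * c + q * (q - 2) * y ^ 2 * k ^ 2 * (c / Y)) := by
    have := mul_le_mul_of_nonneg_left hR2 hK0
    have h3 := mul_le_mul_of_nonneg_right hK (by positivity : 0 ≤ k ^ 2 * c)
    linarith
  -- σ term
  have t6 : -(h ^ 2 * W + k ^ 2 * c) ≤ 2 * σ * h * k := by
    have hWc : 1 ≤ W * c := by
      rw [hRY] at hWR
      have : 1 * Y ≤ (W * c) * Y := by linarith
      exact le_of_mul_le_mul_right this hY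
    have h1 : 0 ≤ (W * h + σ * k) ^ 2 := sq_nonneg _
    have h2 : σ ^ 2 * k ^ 2 ≤ W * c * k ^ 2 := by
      have := mul_le_mul_of_nonneg_right (hσ.trans hWc) (sq_nonneg k); exact this
    have h3 : 0 ≤ W * (h ^ 2 * W + k ^ 2 * c + 2 * σ * h * k) := by linarith
    have := nonneg_of_mul_nonneg_right h3 hW
    linarith
  -- R' bound
  set r := q * y * k * c with hr
  have hr2 : r ^ 2 ≤ q ^ 2 * k ^ 2 * c * M := by
    have h1 : c * y ^ 2 ≤ M := by
      have : c * y ^ 2 ≤ c * Y := mul_le_mul_of_nonneg_left hyY hc0.le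
      rw [hM]; linarith
    have : r ^ 2 = q ^ 2 * k ^ 2 * c * (c * y ^ 2) := by rw [hr]; ring
    rw [this]; apply mul_le_mul_of_nonneg_left h1; positivity
  have hrM : X * (w / M) * r ^ 2 ≤ q ^ 2 * k ^ 2 * c := by
    have h1 : X * (w / M) * r ^ 2 ≤ X * (w / M) * (q ^ 2 * k ^ 2 * c * M) :=
      mul_le_mul_of_nonneg_left hr2 (by positivity)
    have h2 : X * (w / M) * (q ^ 2 * k ^ 2 * c * M) = X * w * (q ^ 2 * k ^ 2 * c) := by field_simp
    rw [h2] at h1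
    have h3 : X * w * (q ^ 2 * k ^ 2 * c) ≤ 1 * (q ^ 2 * k ^ 2 * c) :=
      mul_le_mul_of_nonneg_right hXw (by positivity)
    linarith
  set s := p * x * h * b with hs
  -- square split
  have t3 : 2 / p * θ * X * (w / M) * (s + r) ^ 2 ≤
      4 * θ * x * h * s * w + 4 * q ^ 2 * k ^ 2 * c := by
    have h1 : (s + r) ^ 2 ≤ 2 * s ^ 2 + 2 * r ^ 2 := by linarith [sq_nonneg (s - r)]
    have h2 : 2 / p * θ * X * (w / M) * (s + r) ^ 2 ≤ 2 / p * θ * X * (w / M) * (2 * s ^ 2 + 2 * r ^ 2) :=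
      mul_le_mul_of_nonneg_left h1 (by positivity)
    have h3 : 2 / p * θ * X * (w / M) * (2 * s ^ 2) ≤ 4 * θ * x * h * s * w := by
      have : 2 / p * θ * X * (w / M) * (2 * s ^ 2) = 4 * θ * x * h * s * w * (P / M) := by
        rw [hs, hPX]; field_simp; ring
      rw [this]
      have hPM : P / M ≤ 1 := by rw [div_le_one hM0]; linarith
      have h0 : 0 ≤ 4 * θ * x * h * s * w := by
        have : 4 * θ * x * h * s * w = 4 * θ * w * p * b * (x * h) ^ 2 := by rw [hs]; ring
        rw [this]; positivity
      exact mul_le_of_le_one_right h0 hPM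
    have h4 : 2 / p * θ * X * (w / M) * (2 * r ^ 2) ≤ 2 * (q ^ 2 * k ^ 2 * c) := by
      have h5 : 2 / p * θ ≤ 1 := mul_le_one₀ h2p1 hθ0 hθ1
      have h6 : 0 ≤ X * (w / M) * r ^ 2 := by positivity
      have h8 := mul_le_mul h5 hrM h6 zero_le_one
      linarith
    have h7 : 0 ≤ q ^ 2 * k ^ 2 * c := by positivity
    linarith
  have t2 : -(h ^ 2 * W + 4 * q ^ 2 * k ^ 2 * c) ≤ 4 * θ * x * h * r * w := by
    have h1 : 0 ≤ M * w * (h + 2 * θ * x * r / M) ^ 2 := by positivity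
    have h2 : M * w * (h + 2 * θ * x * r / M) ^ 2 = h ^ 2 * W + 4 * θ * x * h * r * w +
        4 * (θ ^ 2 * (x ^ 2 * (w / M) * r ^ 2)) := by rw [hWw]; field_simp; ring
    have h3 : x ^ 2 * (w / M) * r ^ 2 ≤ X * (w / M) * r ^ 2 := by gcongr
    have h4 : θ ^ 2 * (x ^ 2 * (w / M) * r ^ 2) ≤ 1 * (q ^ 2 * k ^ 2 * c) := by
      apply mul_le_mul (pow_le_one₀ hθ0 hθ1) (h3.trans hrM) (by positivity) (by norm_num)
    linarith
  have e4 : 4 * θ * x * h * ((s + r) * w) = 4 * θ * x * h * s * w + 4 * θ * x * h * r * w := by ring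
  rw [e4]
  linarith [t2, t3, t4, t5, t6]

/-- regularized Bellman function -/
noncomputable def czBe (p q K ε : ℝ) (z : ℝ × ℝ) : ℝ :=
  (z.1 ^ 2 + ε) * ((z.1 ^ 2 + ε) ^ (p / 2) + (z.2 ^ 2 + ε) ^ (q / 2)) ^ (1 - 2 / p)
    + K * (z.2 ^ 2 + ε) ^ (q / 2)

set_option maxHeartbeats 1000000 in
lemma cz_line (p q K ε a h b k σ : ℝ) (hp : 2 ≤ p) (hq : 1 < q) (hq2 : q ≤ 2)
    (hpq : q * (1 - 2 / p) = 2 - q) (hσ : σ ^ 2 ≤ 1)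
    (hK : 8 * q ^ 2 + 1 ≤ K * (q * (q - 1))) (hK0 : 0 ≤ K) (hε : 0 < ε) :
    ConvexOn ℝ Set.univ
      (fun t : ℝ => czBe p q K ε (a + t * h, b + t * k) + σ * ((a + t * h) * (b + t * k))) := by
  have hp0 : 0 < p := by linarith
  set θ := 1 - 2 / p with hθ
  have hθ0 : 0 ≤ θ := by
    rw [hθ]; have : 2 / p ≤ 1 := by rw [div_le_one hp0]; exact hp
    linarith
  have hx : ∀ t : ℝ, HasDerivAt (fun t : ℝ => a + t * h) h t := fun t => by
    simpa using ((hasDerivAt_id t).mul_const h).const_add a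
  have hy : ∀ t : ℝ, HasDerivAt (fun t : ℝ => b + t * k) k t := fun t => by
    simpa using ((hasDerivAt_id t).mul_const k).const_add b
  have hX0 : ∀ t : ℝ, 0 < (a + t * h) ^ 2 + ε := fun t => by positivity
  have hY0 : ∀ t : ℝ, 0 < (b + t * k) ^ 2 + ε := fun t => by positivity
  obtain ⟨x, hxd⟩ : ∃ x : ℝ → ℝ, x = fun t => a + t * h := ⟨_, rfl⟩
  obtain ⟨y, hyd⟩ : ∃ y : ℝ → ℝ, y = fun t => b + t * k := ⟨_, rfl⟩
  have hx : ∀ t : ℝ, HasDerivAt x h t := fun t => by rw [hxd]; exact hx t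
  have hy : ∀ t : ℝ, HasDerivAt y k t := fun t => by rw [hyd]; exact hy t
  obtain ⟨X, hXd⟩ : ∃ X : ℝ → ℝ, X = fun t => x t ^ 2 + ε := ⟨_, rfl⟩
  obtain ⟨Y, hYd⟩ : ∃ Y : ℝ → ℝ, Y = fun t => y t ^ 2 + ε := ⟨_, rfl⟩
  have hX0 : ∀ t : ℝ, 0 < X t := fun t => by rw [hXd]; positivity
  have hY0 : ∀ t : ℝ, 0 < Y t := fun t => by rw [hYd]; positivity
  have hX : ∀ t, HasDerivAt X (2 * x t * h) t := fun t => by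
    rw [hXd]; have := ((hx t).pow 2).add_const ε
    exact this.congr_deriv (by simp)
  have hY : ∀ t, HasDerivAt Y (2 * y t * k) t := fun t => by
    rw [hYd]; have := ((hy t).pow 2).add_const ε
    exact this.congr_deriv (by simp)
  obtain ⟨P, hPd⟩ : ∃ P : ℝ → ℝ, P = fun t => X t ^ (p / 2) := ⟨_, rfl⟩
  obtain ⟨R, hRd⟩ : ∃ R : ℝ → ℝ, R = fun t => Y t ^ (q / 2) := ⟨_, rfl⟩
  have hP0 : ∀ t : ℝ, 0 < P t := fun t => by rw [hPd]; exact Real.rpow_pos_of_pos (hX0 t) _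
  have hR0 : ∀ t : ℝ, 0 < R t := fun t => by rw [hRd]; exact Real.rpow_pos_of_pos (hY0 t) _
  have hP : ∀ t, HasDerivAt P (p * x t * h * (P t / X t)) t := fun t => by
    have := (hX t).rpow_const (p := p / 2) (Or.inl (hX0 t).ne')
    rw [Real.rpow_sub_one (hX0 t).ne'] at this
    rw [hPd]; exact this.congr_deriv (by ring)
  have hR : ∀ t, HasDerivAt R (q * y t * k * (R t / Y t)) t := fun t => by
    have := (hY t).rpow_const (p := q / 2) (Or.inl (hY0 t).ne')
    rw [Real.rpow_sub_one (hY0 t).ne'] at this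
    rw [hRd]; exact this.congr_deriv (by ring)
  have hP2 : ∀ t, HasDerivAt (fun t => p * x t * h * (P t / X t))
      (p * h ^ 2 * (P t / X t) + p * (p - 2) * x t ^ 2 * h ^ 2 * (P t / X t ^ 2)) t := fun t => by
    have := (((hx t).const_mul p).mul_const h).mul ((hP t).div (hX t) (hX0 t).ne')
    refine this.congr_deriv ?_
    have := (hX0 t).ne'
    simp only [Pi.div_apply]
    field_simp
  have hR2 : ∀ t, HasDerivAt (fun t => q * y t * k * (R t / Y t))
      (q * k ^ 2 * (R t / Y t) + q * (q - 2) * y t ^ 2 * k ^ 2 * (R t / Y t ^ 2)) t := fun t => by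
    have := (((hy t).const_mul q).mul_const k).mul ((hR t).div (hY t) (hY0 t).ne')
    refine this.congr_deriv ?_
    have := (hY0 t).ne'
    simp only [Pi.div_apply]
    field_simp
  obtain ⟨W, hWd⟩ : ∃ W : ℝ → ℝ, W = fun t => (P t + R t) ^ θ := ⟨_, rfl⟩
  have hM0 : ∀ t : ℝ, 0 < P t + R t := fun t => add_pos (hP0 t) (hR0 t)
  have hW0 : ∀ t : ℝ, 0 < W t := fun t => by rw [hWd]; exact Real.rpow_pos_of_pos (hM0 t) _
  obtain ⟨M1, hM1d⟩ : ∃ M1 : ℝ → ℝ, M1 = fun t => (p * x t * h * (P t / X t)) + (q * y t * k * (R t / Y t)) := ⟨_, rfl⟩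
  have hM : ∀ t, HasDerivAt (fun t => P t + R t) (M1 t) t := fun t => by
    rw [hM1d]; exact (hP t).add (hR t)
  obtain ⟨M2, hM2d⟩ : ∃ M2 : ℝ → ℝ, M2 = fun t =>
    (p * h ^ 2 * (P t / X t) + p * (p - 2) * x t ^ 2 * h ^ 2 * (P t / X t ^ 2)) +
    (q * k ^ 2 * (R t / Y t) + q * (q - 2) * y t ^ 2 * k ^ 2 * (R t / Y t ^ 2)) := ⟨_, rfl⟩
  have hM1 : ∀ t, HasDerivAt M1 (M2 t) t := fun t => by
    rw [hM1d, hM2d]; exact (hP2 t).add (hR2 t)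
  have hW : ∀ t, HasDerivAt W (θ * M1 t * (W t / (P t + R t))) t := fun t => by
    have := (hM t).rpow_const (p := θ) (Or.inl (hM0 t).ne')
    rw [Real.rpow_sub_one (hM0 t).ne'] at this
    rw [hWd]; exact this.congr_deriv (by ring)
  have hfun : (fun t : ℝ => czBe p q K ε (a + t * h, b + t * k) + σ * ((a + t * h) * (b + t * k)))
      = fun t => X t * W t + K * R t + σ * (x t * y t) := by
    subst hWd hRd hPd hXd hYd hxd hyd
    funext t; simp only [czBe, hθ]
  rw [hfun]
  have hd1 : ∀ t, HasDerivAt (fun t => X t * W t + K * R t + σ * (x t * y t))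
      (2 * x t * h * W t + X t * (θ * M1 t * (W t / (P t + R t))) + K * (q * y t * k * (R t / Y t))
        + σ * (h * y t + x t * k)) t := fun t =>
    ((((hX t).mul (hW t)).add ((hR t).const_mul K)).add (((hx t).mul (hy t)).const_mul σ))
  have hd2 : ∀ t, HasDerivAt (fun t => 2 * x t * h * W t + X t * (θ * M1 t * (W t / (P t + R t))) + K * (q * y t * k * (R t / Y t))
        + σ * (h * y t + x t * k))
      ((2 * h * h * W t + 2 * x t * h * (θ * M1 t * (W t / (P t + R t)))) +
        (2 * x t * h * (θ * M1 t * (W t / (P t + R t))) +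
          X t * (θ * M2 t * (W t / (P t + R t)) + θ * M1 t *
            ((θ * M1 t * (W t / (P t + R t)) * (P t + R t) - W t * M1 t) / (P t + R t) ^ 2)))
        + K * (q * k ^ 2 * (R t / Y t) + q * (q - 2) * y t ^ 2 * k ^ 2 * (R t / Y t ^ 2))
        + σ * (h * k + h * k)) t := fun t =>
    (((((((hx t).const_mul 2).mul_const h).mul (hW t)).add
      ((hX t).mul (((hM1 t).const_mul θ).mul ((hW t).div (hM t) (hM0 t).ne')))).add
      ((hR2 t).const_mul K)).add ((((hy t).const_mul h).add ((hx t).mul_const k)).const_mul σ))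
  refine convexOn_of_hasDerivWithinAt2_nonneg convex_univ
    (fun t _ => (hd1 t).continuousAt.continuousWithinAt)
    (fun t _ => (hd1 t).hasDerivWithinAt) (fun t _ => (hd2 t).hasDerivWithinAt) (fun t _ => ?_)
  have key := cz_alg p q θ K (x t) (y t) h k (X t) (Y t) (P t) (R t) (W t) σ hp hq hq2 hθ (hX0 t)
    (hY0 t) (hP0 t) (hR0 t) (hW0 t) (by rw [hXd]; simp [hε.le]) (by rw [hYd]; simp [hε.le])
    (by
      have h1 : X t ≤ (P t + R t) ^ (2 / p) := by
        have : X t = (P t) ^ (2 / p) := by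
          rw [hPd]; simp only
          rw [← Real.rpow_mul (hX0 t).le]
          have : p / 2 * (2 / p) = 1 := by field_simp
          rw [this, Real.rpow_one]
        rw [this]
        exact Real.rpow_le_rpow (hP0 t).le (by linarith [hR0 t]) (by positivity)
      have h2 : (P t + R t) ^ (2 / p) * W t = P t + R t := by
        rw [hWd]; simp only
        rw [← Real.rpow_add (hM0 t), hθ]
        simp
      rw [← h2]
      exact mul_le_mul_of_nonneg_right h1 (hW0 t).le)
    (by
      have h1 : (R t) ^ θ ≤ W t := by
        rw [hWd]; exact Real.rpow_le_rpow (hR0 t).le (by linarith [hP0 t]) hθ0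
      have h2 : (R t) ^ θ * R t = Y t := by
        rw [hRd]; simp only
        rw [← Real.rpow_mul (hY0 t).le, ← Real.rpow_add (hY0 t)]
        have : q / 2 * θ + q / 2 = 1 := by linarith
        rw [this, Real.rpow_one]
      rw [← h2]
      exact mul_le_mul_of_nonneg_right h1 (hR0 t).le) hσ hK hK0
  refine key.trans (le_of_eq ?_)
  have hM1t : p * x t * h * (P t / X t) + q * y t * k * (R t / Y t) = M1 t := by rw [hM1d]
  have hM2t : (p * h ^ 2 * (P t / X t) + p * (p - 2) * x t ^ 2 * h ^ 2 * (P t / X t ^ 2)) +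
    (q * k ^ 2 * (R t / Y t) + q * (q - 2) * y t ^ 2 * k ^ 2 * (R t / Y t ^ 2)) = M2 t := by rw [hM2d]
  rw [hM1t, hM2t]
  have h2p : 2 / p = 1 - θ := by rw [hθ]; ring
  rw [h2p]
  have := (hM0 t).ne'
  generalize K * (q * k ^ 2 * (R t / Y t) + q * (q - 2) * y t ^ 2 * k ^ 2 * (R t / Y t ^ 2)) = Z
  generalize P t + R t = M at *
  field_simp
  ring

lemma cz_bellman2 (p q : ℝ) (hp : 2 ≤ p) (hpq : p.HolderConjugate q) :
    ∃ C : ℝ, 0 < C ∧ ∃ B : ℝ × ℝ → ℝ, Continuous B ∧ (∀ z, 0 ≤ B z) ∧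
      (∀ z, B z ≤ C * (|z.1| ^ p + |z.2| ^ q)) ∧
      ∀ σ : ℝ, σ ^ 2 ≤ 1 → ConvexOn ℝ Set.univ (fun z : ℝ × ℝ => B z + σ * (z.1 * z.2)) := by
  have hp0 : 0 < p := by linarith
  have hq1 : 1 < q := hpq.symm.lt
  have hsum : p⁻¹ + q⁻¹ = 1 := hpq.inv_add_inv_eq_one
  have hq0 : 0 < q := by linarith
  have hmul : q + p = p * q := by
    have h1 := hp0.ne'
    have h2 := hq0.ne'
    field_simp at hsum
    linarith
  have hq2 : q ≤ 2 := by nlinarith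
  have hθq : q * (1 - 2 / p) = 2 - q := by
    field_simp; nlinarith
  have h2p1 : 2 / p ≤ 1 := by rw [div_le_one hp0]; exact hp
  have hθ0 : 0 ≤ 1 - 2 / p := by linarith
  obtain ⟨K, hKd⟩ : ∃ K : ℝ, K = (8 * q ^ 2 + 1) / (q * (q - 1)) := ⟨_, rfl⟩
  have hqq : 0 < q * (q - 1) := mul_pos hq0 (by linarith)
  have hK0 : 0 ≤ K := by rw [hKd]; positivity
  have hK : 8 * q ^ 2 + 1 ≤ K * (q * (q - 1)) := by
    rw [hKd, div_mul_cancel₀ _ hqq.ne']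
  have habs : ∀ (x r : ℝ), 0 < r → (x ^ 2) ^ (r / 2) = |x| ^ r := fun x r hr => by
    rw [← sq_abs, ← Real.rpow_natCast, ← Real.rpow_mul (abs_nonneg x)]
    congr 1; push_cast; ring
  refine ⟨1 + K, by linarith, czBe p q K 0, ?_, ?_, ?_, ?_⟩
  · unfold czBe
    refine ((by fun_prop : Continuous fun z : ℝ × ℝ => z.1 ^ 2 + (0:ℝ)).mul
      (Continuous.rpow_const (Continuous.add (Continuous.rpow_const (by fun_prop) fun _ => Or.inr (by positivity))
        (Continuous.rpow_const (by fun_prop) fun _ => Or.inr (by positivity))) fun _ => Or.inr hθ0)).add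
      (continuous_const.mul (Continuous.rpow_const (by fun_prop) fun _ => Or.inr (by positivity)))
  · intro z; unfold czBe; simp only [add_zero]; positivity
  · intro z
    unfold czBe
    simp only [add_zero]
    rw [habs _ _ hp0, habs _ _ hq0]
    set M := |z.1| ^ p + |z.2| ^ q with hM
    have hP : 0 ≤ |z.1| ^ p := by positivity
    have hR : 0 ≤ |z.2| ^ q := by positivity
    have hM0 : 0 ≤ M := by positivity
    have h1 : z.1 ^ 2 ≤ M ^ (2 / p) := by
      have : z.1 ^ 2 = (|z.1| ^ p) ^ (2 / p) := by
        rw [← Real.rpow_mul (abs_nonneg _)]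
        have : p * (2 / p) = 2 := by field_simp
        rw [this, ← sq_abs]; norm_cast
      rw [this]
      exact Real.rpow_le_rpow hP (by linarith) (by positivity)
    have h2 : M ^ (2 / p) * M ^ (1 - 2 / p) = M := by
      rw [← Real.rpow_add_of_nonneg hM0 (by positivity) hθ0]; simp
    have h3 : z.1 ^ 2 * M ^ (1 - 2 / p) ≤ M := by
      have := mul_le_mul_of_nonneg_right h1 (Real.rpow_nonneg hM0 (1 - 2 / p))
      linarith
    have h4 : K * |z.2| ^ q ≤ K * M := mul_le_mul_of_nonneg_left (by linarith) hK0
    linarith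
  · intro σ hσ
    refine ⟨convex_univ, ?_⟩
    rintro ⟨z1, z2⟩ - ⟨w1, w2⟩ - s t hs ht hst
    have hlim : ∀ z : ℝ × ℝ, Filter.Tendsto (fun ε => czBe p q K ε z + σ * (z.1 * z.2)) (nhdsWithin 0 (Set.Ioi 0))
        (nhds (czBe p q K 0 z + σ * (z.1 * z.2))) := by
      intro z
      have : Continuous (fun ε => czBe p q K ε z + σ * (z.1 * z.2)) := by
        unfold czBe
        refine Continuous.add (((by fun_prop : Continuous fun ε : ℝ => z.1 ^ 2 + ε).mul
          (Continuous.rpow_const (Continuous.add (Continuous.rpow_const (by fun_prop) fun _ => Or.inr (by positivity))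
            (Continuous.rpow_const (by fun_prop) fun _ => Or.inr (by positivity))) fun _ => Or.inr hθ0)).add
          (continuous_const.mul (Continuous.rpow_const (by fun_prop) fun _ => Or.inr (by positivity)))) continuous_const
      exact (this.tendsto 0).mono_left nhdsWithin_le_nhds
    refine le_of_tendsto_of_tendsto (hlim _) (((hlim (z1, z2)).const_smul s).add ((hlim (w1, w2)).const_smul t)) ?_
    filter_upwards [self_mem_nhdsWithin] with ε hε
    have := (cz_line p q K ε z1 (w1 - z1) z2 (w2 - z2) σ hp hq1 hq2 hθq hσ hK hK0 hε).2
      (Set.mem_univ 0) (Set.mem_univ 1) hs ht hst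
    have e1 : s = 1 - t := by linarith
    subst e1
    simp only [smul_eq_mul, mul_zero, mul_one, zero_add, zero_mul, add_zero, one_mul, add_sub_cancel,
      Prod.smul_mk, Prod.mk_add_mk] at this ⊢
    have e2 : z1 + t * (w1 - z1) = (1 - t) * z1 + t * w1 := by ring
    have e3 : z2 + t * (w2 - z2) = (1 - t) * z2 + t * w2 := by ring
    rw [e2, e3] at this
    exact this

lemma cz_bellman (p q : ℝ) (hpq : p.HolderConjugate q) :
    ∃ C : ℝ, 0 < C ∧ ∃ B : ℝ × ℝ → ℝ, Continuous B ∧ (∀ z, 0 ≤ B z) ∧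
      (∀ z, B z ≤ C * (|z.1| ^ p + |z.2| ^ q)) ∧
      ∀ σ : ℝ, σ ^ 2 ≤ 1 → ConvexOn ℝ Set.univ (fun z : ℝ × ℝ => B z + σ * (z.1 * z.2)) := by
  rcases le_total 2 p with h | h
  · exact cz_bellman2 p q h hpq
  · have hq : 2 ≤ q := by
      have hp0 := hpq.pos
      have hq0 := hpq.symm.pos
      have hsum : p⁻¹ + q⁻¹ = 1 := hpq.inv_add_inv_eq_one
      have h1 := hp0.ne'
      have h2 := hq0.ne'
      field_simp at hsum
      nlinarith
    obtain ⟨C, hC, B, h1, h2, h3, h4⟩ := cz_bellman2 q p hq hpq.symm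
    refine ⟨C, hC, fun z => B z.swap, h1.comp continuous_swap, fun z => h2 _, fun z => ?_, fun σ hσ => ?_⟩
    · have := h3 z.swap
      simp only [Prod.fst_swap, Prod.snd_swap] at this
      linarith
    · refine ⟨convex_univ, fun z _ w _ s t hs ht hst => ?_⟩
      have := (h4 σ hσ).2 (Set.mem_univ z.swap) (Set.mem_univ w.swap) hs ht hst
      simp only [Prod.fst_swap, Prod.snd_swap, Prod.fst_add, Prod.snd_add, Prod.smul_fst, Prod.smul_snd,
        Prod.swap_add, Prod.smul_swap] at this ⊢
      rw [mul_comm (s • z.1 + _), mul_comm z.1, mul_comm w.1]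
      exact this

section flow
set_option linter.unusedSectionVars false
variable {E : Type*} [NormedAddCommGroup E] [NormedSpace ℝ E] [FiniteDimensional ℝ E]
  [MeasurableSpace E] [BorelSpace E]

/-- translation operator -/
def czT (a : E) : Module.End ℝ (E → ℝ) where
  toFun f := fun x => f (x + a)
  map_add' _ _ := rfl
  map_smul' _ _ := rfl

/-- second difference operator -/
def czd (a : E) : Module.End ℝ (E → ℝ) := czT a + czT (-a) - (1 + 1)

/-- continuous compactly supported functions -/
def czCC (E : Type*) [NormedAddCommGroup E] : Submodule ℝ (E → ℝ) where
  carrier := {f | Continuous f ∧ HasCompactSupport f}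
  add_mem' := fun hf hg => ⟨hf.1.add hg.1, hf.2.add hg.2⟩
  zero_mem' := ⟨continuous_const, HasCompactSupport.zero⟩
  smul_mem' := fun c _ hf => ⟨continuous_const.mul hf.1, hf.2.mul_left (f := fun _ => c)⟩

lemma czT_apply (a : E) (f : E → ℝ) (x : E) : czT a f x = f (x + a) := rfl

lemma czd_apply (a : E) (f : E → ℝ) (x : E) : czd a f x = f (x + a) + f (x - a) - 2 * f x := by
  have : czd a f x = f (x + a) + f (x + -a) - (f x + f x) := rfl
  rw [this, sub_eq_add_neg x a]
  ring

lemma czT_mem (a : E) {f : E → ℝ} (hf : f ∈ czCC E) : czT a f ∈ czCC E :=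
  ⟨hf.1.comp (continuous_add_const a), hf.2.comp_homeomorph (Homeomorph.addRight a)⟩

lemma czd_mem (a : E) {f : E → ℝ} (hf : f ∈ czCC E) : czd a f ∈ czCC E := by
  have : czd a f = czT a f + czT (-a) f - (f + f) := rfl
  rw [this]
  exact (czCC E).sub_mem ((czCC E).add_mem (czT_mem a hf) (czT_mem _ hf)) ((czCC E).add_mem hf hf)

lemma czT_comm (a b : E) : Commute (czT a) (czT b) := by
  ext f x
  simp only [Module.End.mul_apply, czT_apply]
  congr 1; abel

lemma czd_comm (a b : E) : Commute (czd a) (czd b) := by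
  have h2 : ∀ X : Module.End ℝ (E → ℝ), Commute X (1 + 1) := fun X =>
    (Commute.one_right X).add_right (Commute.one_right X)
  have h3 : ∀ c, Commute (czT c) (czd b) := fun c =>
    ((czT_comm c b).add_right (czT_comm c _)).sub_right (h2 _)
  exact ((h3 a).add_left (h3 _)).sub_left (h2 _).symm

variable {ι : Type*} [Fintype ι]

/-- discrete Laplacian -/
def czL (S : ι → E) : Module.End ℝ (E → ℝ) := ∑ i, czd (S i)

/-- averaging operator -/
noncomputable def czA (S : ι → E) : Module.End ℝ (E → ℝ) :=
  1 + (1 / (4 * (Fintype.card ι : ℝ))) • czL S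

lemma czL_mem (S : ι → E) {f : E → ℝ} (hf : f ∈ czCC E) : czL S f ∈ czCC E := by
  rw [czL, LinearMap.sum_apply]
  exact (czCC E).sum_mem fun i _ => czd_mem _ hf

lemma czA_mem (S : ι → E) {f : E → ℝ} (hf : f ∈ czCC E) : czA S f ∈ czCC E := by
  rw [czA, LinearMap.add_apply, LinearMap.smul_apply]
  exact (czCC E).add_mem hf ((czCC E).smul_mem _ (czL_mem S hf))

lemma czAk_mem (S : ι → E) (k : ℕ) {f : E → ℝ} (hf : f ∈ czCC E) : (czA S ^ k) f ∈ czCC E := by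
  induction k with
  | zero => simpa using hf
  | succ k ih => rw [pow_succ', Module.End.mul_apply]; exact czA_mem S ih

lemma czdL_comm (a : E) (S : ι → E) : Commute (czd a) (czL S) :=
  Commute.sum_right _ _ _ fun i _ => czd_comm a (S i)

lemma czdA_comm (a : E) (S : ι → E) : Commute (czd a) (czA S) :=
  (Commute.one_right _).add_right ((czdL_comm a S).smul_right _)

lemma czLA_comm (S : ι → E) : Commute (czL S) (czA S) :=
  (Commute.one_right _).add_right ((Commute.refl _).smul_right _)

lemma cz_op_id (S : ι → E) (a : E) (k : ℕ) :
    czd a * czA S ^ k - czA S * (czd a * czA S ^ (k + 1)) =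
      -((1 / (4 * (Fintype.card ι : ℝ))) • (czd a * (czA S ^ k * (czL S * (1 + czA S))))) := by
  have h1 : (1 / (4 * (Fintype.card ι : ℝ))) • czL S = czA S - 1 := by rw [czA]; simp
  have h2 : -((1 / (4 * (Fintype.card ι : ℝ))) • (czd a * (czA S ^ k * (czL S * (1 + czA S))))) =
      - (czd a * (czA S ^ k * ((czA S - 1) * (1 + czA S)))) := by
    rw [← h1]; simp only [smul_mul_assoc, mul_smul_comm]
  rw [h2]
  have h3 : czA S * (czd a * czA S ^ (k + 1)) = czd a * czA S ^ k * czA S * czA S := by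
    rw [← mul_assoc, ← (czdA_comm a S).eq, mul_assoc, ← pow_succ', mul_assoc, mul_assoc, ← mul_assoc (czA S ^ k), ← pow_succ, ← pow_succ]
  rw [h3]
  simp only [sub_mul, mul_sub, mul_add, mul_one, one_mul, mul_assoc]
  abel

variable (μ : Measure E) [μ.IsAddHaarMeasure]

lemma cz_int_mul {f g : E → ℝ} (hf : f ∈ czCC E) (hg : g ∈ czCC E) :
    Integrable (fun x => f x * g x) μ :=
  (hf.1.mul hg.1).integrable_of_hasCompactSupport (hf.2.mul_right)

lemma cz_int {f : E → ℝ} (hf : f ∈ czCC E) : Integrable f μ :=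
  hf.1.integrable_of_hasCompactSupport hf.2

lemma czT_adj (a : E) (f g : E → ℝ) :
    ∫ x, czT a f x * g x ∂μ = ∫ x, f x * czT (-a) g x ∂μ := by
  rw [← integral_add_right_eq_self (fun x => f x * czT (-a) g x) a]
  simp [czT_apply]

lemma czd_adj (a : E) {f g : E → ℝ} (hf : f ∈ czCC E) (hg : g ∈ czCC E) :
    ∫ x, czd a f x * g x ∂μ = ∫ x, f x * czd a g x ∂μ := by
  have e1 : ∀ x, czd a f x * g x = czT a f x * g x + czT (-a) f x * g x - 2 * (f x * g x) := fun x => by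
    rw [czd_apply, czT_apply, czT_apply, sub_eq_add_neg x a]; ring
  have e2 : ∀ x, f x * czd a g x = f x * czT (-a) g x + f x * czT a g x - 2 * (f x * g x) := fun x => by
    rw [czd_apply, czT_apply, czT_apply, sub_eq_add_neg x a]; ring
  simp_rw [e1, e2]
  rw [integral_sub, integral_sub, integral_add, integral_add, czT_adj, czT_adj, neg_neg]
  all_goals first
    | exact (cz_int_mul μ hf hg).const_mul 2
    | skip
  all_goals first
    | exact cz_int_mul μ (czT_mem _ hf) hg
    | exact cz_int_mul μ hf (czT_mem _ hg)
    | exact (cz_int_mul μ (czT_mem _ hf) hg).add (cz_int_mul μ (czT_mem _ hf) hg)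
    | exact (cz_int_mul μ hf (czT_mem _ hg)).add (cz_int_mul μ hf (czT_mem _ hg))

lemma czA_adj (S : ι → E) {f g : E → ℝ} (hf : f ∈ czCC E) (hg : g ∈ czCC E) :
    ∫ x, czA S f x * g x ∂μ = ∫ x, f x * czA S g x ∂μ := by
  have e1 : ∀ x, czA S f x * g x = f x * g x + (1 / (4 * (Fintype.card ι : ℝ))) *
      ∑ i, czd (S i) f x * g x := fun x => by
    simp only [czA, czL, LinearMap.add_apply, Pi.add_apply, Module.End.one_apply, LinearMap.smul_apply,
      Pi.smul_apply, LinearMap.sum_apply, Finset.sum_apply, smul_eq_mul]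
    rw [add_mul, mul_assoc, Finset.sum_mul]
  have e2 : ∀ x, f x * czA S g x = f x * g x + (1 / (4 * (Fintype.card ι : ℝ))) *
      ∑ i, f x * czd (S i) g x := fun x => by
    simp only [czA, czL, LinearMap.add_apply, Pi.add_apply, Module.End.one_apply, LinearMap.smul_apply,
      Pi.smul_apply, LinearMap.sum_apply, Finset.sum_apply, smul_eq_mul]
    rw [mul_add, mul_left_comm, Finset.mul_sum]
  simp_rw [e1, e2]
  rw [integral_add, integral_add, integral_const_mul, integral_const_mul, integral_finsetSum, integral_finsetSum]
  · congr 2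
    exact Finset.sum_congr rfl fun i _ => czd_adj μ (S i) hf hg
  · exact fun i _ => cz_int_mul μ hf (czd_mem _ hg)
  · exact fun i _ => cz_int_mul μ (czd_mem _ hf) hg
  · exact cz_int_mul μ hf hg
  · exact (integrable_finsetSum _ fun i _ => cz_int_mul μ hf (czd_mem _ hg)).const_mul _
  · exact cz_int_mul μ hf hg
  · exact (integrable_finsetSum _ fun i _ => cz_int_mul μ (czd_mem _ hf) hg).const_mul _

/-- first difference -/
def czD (a : E) (f : E → ℝ) (x : E) : ℝ := f (x + a) - f x

lemma czD_mem (a : E) {f : E → ℝ} (hf : f ∈ czCC E) : czD a f ∈ czCC E :=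
  (czCC E).sub_mem (czT_mem a hf) hf

lemma czD_adj (a : E) {f g : E → ℝ} (hf : f ∈ czCC E) (hg : g ∈ czCC E) :
    ∫ x, czd a f x * g x ∂μ = - ∫ x, czD a f x * czD a g x ∂μ := by
  have e1 : ∀ x, czd a f x * g x = czT a f x * g x + czT (-a) f x * g x - 2 * (f x * g x) := fun x => by
    rw [czd_apply, czT_apply, czT_apply, sub_eq_add_neg x a]; ring
  have e2 : ∀ x, czD a f x * czD a g x = (czT a f x * czT a g x + f x * g x) -
      (czT a f x * g x + f x * czT a g x) := fun x => by
    simp only [czD, czT_apply]; ring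
  have e3 : ∫ x, czT a f x * czT a g x ∂μ = ∫ x, f x * g x ∂μ :=
    integral_add_right_eq_self (fun x => f x * g x) a
  simp_rw [e1, e2]
  have i1 := cz_int_mul μ (czT_mem a hf) hg
  have i2 := cz_int_mul μ (czT_mem (-a) hf) hg
  have i3 := cz_int_mul μ hf hg
  have i4 := cz_int_mul μ (czT_mem a hf) (czT_mem a hg)
  have i5 := cz_int_mul μ hf (czT_mem a hg)
  have j1 : Integrable (fun x => czT a f x * g x + czT (-a) f x * g x) μ := i1.add i2
  have j2 : Integrable (fun x => czT a f x * czT a g x + f x * g x) μ := i4.add i3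
  have j3 : Integrable (fun x => czT a f x * g x + f x * czT a g x) μ := i1.add i5
  rw [integral_sub j1 (i3.const_mul 2), integral_sub j2 j3,
    integral_add i1 i2, integral_add i4 i3, integral_add i1 i5, e3, integral_const_mul,
    czT_adj μ (-a), neg_neg]
  ring
end flow

section flow2
set_option linter.unusedSectionVars false
variable {E : Type*} [NormedAddCommGroup E] [NormedSpace ℝ E] [FiniteDimensional ℝ E]
  [MeasurableSpace E] [BorelSpace E]
variable {ι : Type*} [Fintype ι]

/-- The properties of a Bellman function. -/
structure CzBell (B : ℝ × ℝ → ℝ) : Prop where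
  cont : Continuous B
  nonneg : ∀ z, 0 ≤ B z
  zero : B 0 = 0
  conv : ∀ σ : ℝ, σ ^ 2 ≤ 1 → ConvexOn ℝ Set.univ (fun z : ℝ × ℝ => B z + σ * (z.1 * z.2))

lemma CzBell.convex {B : ℝ × ℝ → ℝ} (hB : CzBell B) : ConvexOn ℝ Set.univ B := by
  simpa using hB.conv 0 (by norm_num)

lemma CzBell.mid {B : ℝ × ℝ → ℝ} (hB : CzBell B) (z w : ℝ × ℝ) :
    B ((1 / 2 : ℝ) • z + (1 / 2 : ℝ) • w) ≤
      1 / 2 * B z + 1 / 2 * B w - 1 / 4 * |(w.1 - z.1) * (w.2 - z.2)| := by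
  have h1 := (hB.conv 1 (by norm_num)).2 (Set.mem_univ z) (Set.mem_univ w)
    (by norm_num : (0:ℝ) ≤ 1 / 2) (by norm_num : (0:ℝ) ≤ 1 / 2) (by norm_num)
  have h2 := (hB.conv (-1) (by norm_num)).2 (Set.mem_univ z) (Set.mem_univ w)
    (by norm_num : (0:ℝ) ≤ 1 / 2) (by norm_num : (0:ℝ) ≤ 1 / 2) (by norm_num)
  simp only [Prod.fst_add, Prod.snd_add, Prod.smul_fst, Prod.smul_snd, smul_eq_mul] at h1 h2
  rcases abs_cases ((w.1 - z.1) * (w.2 - z.2)) with ⟨h, _⟩ | ⟨h, _⟩ <;> rw [h] <;> linarith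

lemma CzBell.comp_mem {B : ℝ × ℝ → ℝ} (hB : CzBell B) {u w : E → ℝ} (hu : u ∈ czCC E) (hw : w ∈ czCC E) :
    (fun x => B (u x, w x)) ∈ czCC E := by
  refine ⟨hB.cont.comp (hu.1.prodMk hw.1), ?_⟩
  apply (hu.2.union hw.2).of_isClosed_subset (isClosed_tsupport _)
  apply closure_minimal _ ((isClosed_tsupport _).union (isClosed_tsupport _))
  intro x hx
  by_contra hcon
  rw [Set.mem_union, not_or] at hcon
  apply hx
  have h1 := image_eq_zero_of_notMem_tsupport hcon.1
  have h2 := image_eq_zero_of_notMem_tsupport hcon.2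
  simp only [h1, h2]
  exact hB.zero

lemma czA_apply (S : ι → E) (f : E → ℝ) (x : E) : czA S f x = f x + (1 / (4 * (Fintype.card ι : ℝ))) *
      ∑ i, (f (x + S i) + f (x - S i) - 2 * f x) := by
  simp only [czA, czL, LinearMap.add_apply, Pi.add_apply, Module.End.one_apply, LinearMap.smul_apply,
      Pi.smul_apply, LinearMap.sum_apply, Finset.sum_apply, smul_eq_mul, czd_apply]

lemma cz_jensen [Nonempty ι] {B : ℝ × ℝ → ℝ} (hB : CzBell B) (S : ι → E) (j : ι) (u w : E → ℝ) (x : E) :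
    B (czA S u x, czA S w x) ≤ czA S (fun y => B (u y, w y)) x
      - 1 / (4 * (Fintype.card ι : ℝ)) * (1 / 2 * |czD (S j) u x * czD (S j) w x|) := by
  have hN : (0:ℝ) < Fintype.card ι := by exact_mod_cast Fintype.card_pos
  set N : ℝ := (Fintype.card ι : ℝ) with hNd
  let U : E → ℝ × ℝ := fun y => (u y, w y)
  let m : ι → ℝ × ℝ := fun i => (1 / 2 : ℝ) • ((1 / 2 : ℝ) • U x + (1 / 2 : ℝ) • U (x + S i)) +
    (1 / 2 : ℝ) • ((1 / 2 : ℝ) • U x + (1 / 2 : ℝ) • U (x - S i))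
  have hm : ∀ i, B (m i) ≤ 1 / 2 * B (U x) + 1 / 4 * B (U (x + S i)) + 1 / 4 * B (U (x - S i))
      - 1 / 8 * |czD (S i) u x * czD (S i) w x| := by
    intro i
    have h1 := hB.convex.2 (Set.mem_univ ((1 / 2 : ℝ) • U x + (1 / 2 : ℝ) • U (x + S i)))
      (Set.mem_univ ((1 / 2 : ℝ) • U x + (1 / 2 : ℝ) • U (x - S i)))
      (by norm_num : (0:ℝ) ≤ 1 / 2) (by norm_num : (0:ℝ) ≤ 1 / 2) (by norm_num)
    have h2 := hB.mid (U x) (U (x + S i))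
    have h3 := hB.mid (U x) (U (x - S i))
    have h4 : |(((U (x + S i)).1 - (U x).1) * ((U (x + S i)).2 - (U x).2))| = |czD (S i) u x * czD (S i) w x| := rfl
    rw [h4] at h2
    have h5 := abs_nonneg (((U (x - S i)).1 - (U x).1) * ((U (x - S i)).2 - (U x).2))
    simp only [smul_eq_mul] at h1
    change B (m i) ≤ _ at h1
    linarith
  have hJ := hB.convex.map_sum_le (t := Finset.univ) (w := fun _ : ι => 1 / N) (p := m)
    (fun i _ => by positivity) (by simp [← hNd]) (fun i _ => Set.mem_univ _)
  have hc : ∑ i : ι, (1 / N) • m i = (czA S u x, czA S w x) := by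
    have hcs : ∀ c : ℝ, ∑ _i : ι, c = N * c := fun c => by simp [← hNd]
    ext
    · simp only [m, U, Prod.fst_sum, Prod.smul_fst, Prod.fst_add, smul_eq_mul, czA_apply, ← Finset.mul_sum,
        Finset.sum_add_distrib, Finset.sum_sub_distrib, hcs, ← hNd]
      field_simp; ring
    · simp only [m, U, Prod.snd_sum, Prod.smul_snd, Prod.snd_add, smul_eq_mul, czA_apply, ← Finset.mul_sum,
        Finset.sum_add_distrib, Finset.sum_sub_distrib, hcs, ← hNd]
      field_simp; ring
  rw [hc] at hJ
  refine hJ.trans ?_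
  simp only [smul_eq_mul, ← Finset.mul_sum]
  have hs : ∑ i, B (m i) ≤ ∑ i, (1 / 2 * B (U x) + 1 / 4 * B (U (x + S i)) + 1 / 4 * B (U (x - S i)))
      - 1 / 8 * |czD (S j) u x * czD (S j) w x| := by
    refine (Finset.sum_le_sum fun i _ => hm i).trans ?_
    rw [Finset.sum_sub_distrib]
    have := Finset.single_le_sum (f := fun i => 1 / 8 * |czD (S i) u x * czD (S i) w x|)
      (fun i _ => by positivity) (Finset.mem_univ j)
    linarith
  refine (mul_le_mul_of_nonneg_left hs (by positivity : 0 ≤ 1 / N)).trans (le_of_eq ?_)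
  have hcs : ∀ c : ℝ, ∑ _i : ι, c = N * c := fun c => by simp [← hNd]
  simp only [U, czA_apply, ← Finset.mul_sum,
        Finset.sum_add_distrib, Finset.sum_sub_distrib, hcs, ← hNd]
  field_simp; ring

variable (μ : Measure E) [μ.IsAddHaarMeasure]

lemma czT_int (a : E) (f : E → ℝ) : ∫ x, f (x + a) ∂μ = ∫ x, f x ∂μ := integral_add_right_eq_self f a

lemma czA_int (S : ι → E) {f : E → ℝ} (hf : f ∈ czCC E) : ∫ x, czA S f x ∂μ = ∫ x, f x ∂μ := by
  simp_rw [czA_apply]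
  have hd : ∀ i, Integrable (fun x => f (x + S i) + f (x - S i) - 2 * f x) μ := fun i => by
    have := cz_int μ (czd_mem (S i) hf)
    refine this.congr (Filter.Eventually.of_forall fun x => czd_apply _ _ _)
  rw [integral_add (cz_int μ hf) ((integrable_finsetSum _ fun i _ => hd i).const_mul _), integral_const_mul,
    integral_finsetSum _ fun i _ => hd i]
  have : ∀ i, ∫ x, f (x + S i) + f (x - S i) - 2 * f x ∂μ = 0 := fun i => by
    have i1 : Integrable (fun x => f (x + S i)) μ := cz_int μ (czT_mem (S i) hf)
    have i2 : Integrable (fun x => f (x - S i)) μ := by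
      refine (cz_int μ (czT_mem (-S i) hf)).congr (Filter.Eventually.of_forall fun x => ?_)
      simp [czT_apply, sub_eq_add_neg]
    have i3 : Integrable (fun x => f (x + S i) + f (x - S i)) μ := i1.add i2
    rw [integral_sub i3 ((cz_int μ hf).const_mul 2), integral_add i1 i2, integral_const_mul, czT_int]
    simp_rw [sub_eq_add_neg]
    rw [czT_int]; ring
  simp [this]

lemma cz_step [Nonempty ι] {B : ℝ × ℝ → ℝ} (hB : CzBell B) (S : ι → E) (j : ι) {u w : E → ℝ}
    (hu : u ∈ czCC E) (hw : w ∈ czCC E) :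
    1 / (4 * (Fintype.card ι : ℝ)) * (1 / 2 * ∫ x, |czD (S j) u x * czD (S j) w x| ∂μ) ≤
      ∫ x, B (u x, w x) ∂μ - ∫ x, B (czA S u x, czA S w x) ∂μ := by
  have hBm := hB.comp_mem hu hw
  have hBm' := hB.comp_mem (czA_mem S hu) (czA_mem S hw)
  have iD : Integrable (fun x => |czD (S j) u x * czD (S j) w x|) μ :=
    (cz_int_mul μ (czD_mem (S j) hu) (czD_mem (S j) hw)).abs
  have h := integral_mono (cz_int μ hBm') ((cz_int μ (czA_mem S hBm)).sub ((iD.const_mul (1/2)).const_mul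
    (1 / (4 * (Fintype.card ι : ℝ))))) (fun x => cz_jensen hB S j u w x)
  simp only [Pi.sub_apply] at h
  rw [integral_sub (cz_int μ (czA_mem S hBm)) ((iD.const_mul (1/2)).const_mul _), integral_const_mul,
    integral_const_mul, czA_int μ S hBm] at h
  linarith

lemma cz_sum [Nonempty ι] {B : ℝ × ℝ → ℝ} (hB : CzBell B) (S : ι → E) (j : ι) {u w : E → ℝ}
    (hu : u ∈ czCC E) (hw : w ∈ czCC E) (K : ℕ) :
    1 / (4 * (Fintype.card ι : ℝ)) * ∑ k ∈ Finset.range K,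
      ∫ x, |czD (S j) ((czA S ^ k) u) x * czD (S j) ((czA S ^ k) w) x| ∂μ ≤ 2 * ∫ x, B (u x, w x) ∂μ := by
  have h1 : ∀ K : ℕ, 1 / (4 * (Fintype.card ι : ℝ)) * (1 / 2 * ∑ k ∈ Finset.range K,
      ∫ x, |czD (S j) ((czA S ^ k) u) x * czD (S j) ((czA S ^ k) w) x| ∂μ) ≤
      ∫ x, B (u x, w x) ∂μ - ∫ x, B ((czA S ^ K) u x, (czA S ^ K) w x) ∂μ := by
    intro K
    induction K with
    | zero => simp
    | succ K ih =>
      have := cz_step μ hB S j (czAk_mem S K hu) (czAk_mem S K hw)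
      rw [Finset.sum_range_succ, pow_succ', Module.End.mul_apply, Module.End.mul_apply]
      linarith
  have h2 : 0 ≤ ∫ x, B ((czA S ^ K) u x, (czA S ^ K) w x) ∂μ := integral_nonneg fun x => hB.nonneg _
  linarith [h1 K]

lemma cz_quad : CzBell (fun z : ℝ × ℝ => 1 / 2 * (z.1 ^ 2 + z.2 ^ 2)) where
  cont := by fun_prop
  nonneg z := by positivity
  zero := by simp
  conv σ hσ := by
    refine ⟨convex_univ, fun z _ w _ s t hs ht hst => ?_⟩
    simp only [Prod.fst_add, Prod.snd_add, Prod.smul_fst, Prod.smul_snd, smul_eq_mul]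
    obtain rfl : s = 1 - t := by linarith
    have h1 : 0 ≤ (1 - t) * t * (((z.1 - w.1) + σ * (z.2 - w.2)) ^ 2 + (1 - σ ^ 2) * (z.2 - w.2) ^ 2) := by
      have : 0 ≤ 1 - σ ^ 2 := by linarith
      positivity
    linarith

lemma cz_energy [Nonempty ι] (S : ι → E) (j : ι) {u : E → ℝ} (hu : u ∈ czCC E) :
    Filter.Tendsto (fun k => ∫ x, |czD (S j) ((czA S ^ k) u) x * czD (S j) ((czA S ^ k) u) x| ∂μ)
      Filter.atTop (nhds 0) := by
  have hN : (0:ℝ) < Fintype.card ι := by exact_mod_cast Fintype.card_pos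
  apply Summable.tendsto_atTop_zero
  refine summable_of_sum_range_le (c := (4 * (Fintype.card ι : ℝ)) * (2 * ∫ x, 1 / 2 * ((u x) ^ 2 + (u x) ^ 2) ∂μ))
    (fun k => integral_nonneg fun x => abs_nonneg _) (fun K => ?_)
  have := cz_sum μ cz_quad S j hu hu K
  rw [one_div_mul_eq_div, div_le_iff₀ (by positivity)] at this
  linarith
end flow2

section flow3
set_option linter.unusedSectionVars false
variable {E : Type*} [NormedAddCommGroup E] [NormedSpace ℝ E] [FiniteDimensional ℝ E]
  [MeasurableSpace E] [BorelSpace E]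
variable {ι : Type*} [Fintype ι]
variable (μ : Measure E) [μ.IsAddHaarMeasure]

lemma cz_F_diff (S : ι → E) (a : E) {v g : E → ℝ} (hv : v ∈ czCC E) (hg : g ∈ czCC E) (k : ℕ) :
    (∫ x, czd a ((czA S ^ k) v) x * (czA S ^ k) g x ∂μ) -
      (∫ x, czd a ((czA S ^ (k + 1)) v) x * (czA S ^ (k + 1)) g x ∂μ) =
    1 / (4 * (Fintype.card ι : ℝ)) * ∫ x, czD a ((czA S ^ k) ((czL S * (1 + czA S)) v)) x *
      czD a ((czA S ^ k) g) x ∂μ := by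
  have hf : (czL S * (1 + czA S)) v ∈ czCC E := by
    rw [Module.End.mul_apply]
    exact czL_mem S ((czCC E).add_mem hv (czA_mem S hv))
  have hgk := czAk_mem S k hg
  have e1 : (∫ x, czd a ((czA S ^ (k + 1)) v) x * (czA S ^ (k + 1)) g x ∂μ) =
      ∫ x, czA S (czd a ((czA S ^ (k + 1)) v)) x * (czA S ^ k) g x ∂μ := by
    rw [czA_adj μ S (czd_mem a (czAk_mem S (k+1) hv)) hgk]
    rw [pow_succ' (czA S) k]; rfl
  rw [e1, ← integral_sub (cz_int_mul μ (czd_mem a (czAk_mem S k hv)) hgk)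
    (cz_int_mul μ (czA_mem S (czd_mem a (czAk_mem S (k+1) hv))) hgk)]
  have e2 := czD_adj μ a (czAk_mem S k hf) hgk
  have e3 : ∀ x, czd a ((czA S ^ k) v) x * (czA S ^ k) g x - czA S (czd a ((czA S ^ (k + 1)) v)) x * (czA S ^ k) g x
      = -(1 / (4 * (Fintype.card ι : ℝ))) * (czd a ((czA S ^ k) ((czL S * (1 + czA S)) v)) x * (czA S ^ k) g x) := by
    intro x
    have := congrFun (LinearMap.congr_fun (cz_op_id S a k) v) x
    simp only [LinearMap.sub_apply, Module.End.mul_apply, LinearMap.neg_apply, LinearMap.smul_apply,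
      Pi.sub_apply, Pi.neg_apply, Pi.smul_apply, smul_eq_mul] at this
    rw [← sub_mul, this]
    simp only [Module.End.mul_apply]
    ring
  simp_rw [e3]
  rw [integral_const_mul, e2]
  ring

lemma cz_discrete [Nonempty ι] {B : ℝ × ℝ → ℝ} (hB : CzBell B) (S : ι → E) (j : ι) {v g : E → ℝ}
    (hv : v ∈ czCC E) (hg : g ∈ czCC E) :
    |∫ x, czd (S j) v x * g x ∂μ| ≤ 2 * ∫ x, B ((czL S * (1 + czA S)) v x, g x) ∂μ := by
  have hf : (czL S * (1 + czA S)) v ∈ czCC E := by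
    rw [Module.End.mul_apply]
    exact czL_mem S ((czCC E).add_mem hv (czA_mem S hv))
  have hN : (0:ℝ) < Fintype.card ι := by exact_mod_cast Fintype.card_pos
  set F : ℕ → ℝ := fun k => ∫ x, czd (S j) ((czA S ^ k) v) x * (czA S ^ k) g x ∂μ with hF
  have h1 : ∀ K, |F 0| ≤ |F K| + 2 * ∫ x, B ((czL S * (1 + czA S)) v x, g x) ∂μ := by
    intro K
    have ht : F 0 - F K = ∑ k ∈ Finset.range K, (F k - F (k+1)) := (Finset.sum_range_sub' F K).symm
    have h2 : |F 0 - F K| ≤ 2 * ∫ x, B ((czL S * (1 + czA S)) v x, g x) ∂μ := by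
      rw [ht]
      refine (Finset.abs_sum_le_sum_abs _ _).trans (le_trans ?_ (cz_sum μ hB S j hf hg K))
      rw [Finset.mul_sum]
      refine Finset.sum_le_sum fun k _ => ?_
      rw [hF]
      simp only
      rw [cz_F_diff μ S (S j) hv hg k, abs_mul, abs_of_nonneg (by positivity)]
      exact mul_le_mul_of_nonneg_left (abs_integral_le_integral_abs) (by positivity)
    have : |F 0| ≤ |F K| + |F 0 - F K| := by
      have := abs_add_le (F K) (F 0 - F K); simpa using this
    linarith
  have h3 : ∀ K, |F K| ≤ 1 / 2 * (∫ x, |czD (S j) ((czA S ^ K) v) x * czD (S j) ((czA S ^ K) v) x| ∂μ) +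
      1 / 2 * (∫ x, |czD (S j) ((czA S ^ K) g) x * czD (S j) ((czA S ^ K) g) x| ∂μ) := by
    intro K
    have hvk := czD_mem (S j) (czAk_mem S K hv)
    have hgk := czD_mem (S j) (czAk_mem S K hg)
    rw [hF]; simp only
    rw [czD_adj μ (S j) (czAk_mem S K hv) (czAk_mem S K hg), abs_neg, ← integral_const_mul, ← integral_const_mul,
      ← integral_add ((cz_int_mul μ hvk hvk).abs.const_mul _) ((cz_int_mul μ hgk hgk).abs.const_mul _)]
    refine abs_integral_le_integral_abs.trans ?_
    refine integral_mono (cz_int_mul μ hvk hgk).abs (((cz_int_mul μ hvk hvk).abs.const_mul _).add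
      ((cz_int_mul μ hgk hgk).abs.const_mul _)) (fun x => ?_)
    simp only [abs_mul]
    nlinarith [sq_nonneg (|czD (S j) ((czA S ^ K) v) x| - |czD (S j) ((czA S ^ K) g) x|)]
  have h4 : Filter.Tendsto (fun K => 1 / 2 * (∫ x, |czD (S j) ((czA S ^ K) v) x * czD (S j) ((czA S ^ K) v) x| ∂μ) +
      1 / 2 * (∫ x, |czD (S j) ((czA S ^ K) g) x * czD (S j) ((czA S ^ K) g) x| ∂μ) +
      2 * ∫ x, B ((czL S * (1 + czA S)) v x, g x) ∂μ) Filter.atTop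
      (nhds (1 / 2 * 0 + 1 / 2 * 0 + 2 * ∫ x, B ((czL S * (1 + czA S)) v x, g x) ∂μ)) :=
    (((cz_energy μ S j hv).const_mul _).add ((cz_energy μ S j hg).const_mul _)).add_const _
  have h5 := ge_of_tendsto' h4 (fun K => (h1 K).trans (add_le_add (h3 K) le_rfl))
  simpa [hF] using h5

end flow3

section flow4
set_option linter.unusedSectionVars false
variable {E : Type*} [NormedAddCommGroup E] [NormedSpace ℝ E] [FiniteDimensional ℝ E]
  [MeasurableSpace E] [BorelSpace E]
variable {ι : Type*} [Fintype ι]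
variable (μ : Measure E) [μ.IsAddHaarMeasure]

lemma czCC_comp {φ : ℝ → ℝ} (hφ : Continuous φ) (h0 : φ 0 = 0) {u : E → ℝ} (hu : u ∈ czCC E) :
    (fun x => φ (u x)) ∈ czCC E :=
  ⟨hφ.comp hu.1, hu.2.comp_left h0⟩

lemma czCC_memLp {u : E → ℝ} (hu : u ∈ czCC E) (P : ENNReal) : MemLp u P μ :=
  hu.1.memLp_of_hasCompactSupport hu.2

lemma cz_dual (p q : ℝ) (hpq : p.HolderConjugate q) : ∃ C : ℝ, 0 < C ∧
    ∀ [Nonempty ι] (S : ι → E) (j : ι) (v : E → ℝ), v ∈ czCC E →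
      ∫ x, |czd (S j) v x| ^ p ∂μ ≤ C * ∫ x, |(czL S * (1 + czA S)) v x| ^ p ∂μ := by
  obtain ⟨C, hC, B, hBc, hB0, hBu, hBv⟩ := cz_bellman p q hpq
  have hp1 : 1 < p := hpq.lt
  have hq1 : 1 < q := hpq.symm.lt
  have hp0 : 0 < p := by linarith
  have hq0 : 0 < q := by linarith
  have hB : CzBell B := by
    refine ⟨hBc, hB0, le_antisymm ?_ (hB0 0), hBv⟩
    have := hBu 0
    simpa [Real.zero_rpow hp0.ne', Real.zero_rpow hq0.ne'] using this
  set s : ℝ := (1 / (4 * C)) ^ (1 / (q - 1)) with hs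
  have hs0 : 0 < s := Real.rpow_pos_of_pos (by positivity) _
  have hsq : 2 * C * s ^ q = s / 2 := by
    have h1 : s ^ (q - 1) = 1 / (4 * C) := by
      rw [hs, ← Real.rpow_mul (by positivity), one_div_mul_cancel (by linarith), Real.rpow_one]
    have h2 : s ^ q = s ^ (q - 1) * s := by
      rw [← Real.rpow_add_one hs0.ne']; congr 1; ring
    rw [h2, h1]; field_simp; ring
  refine ⟨4 * C / s, by positivity, ?_⟩
  intro _ S j v hv
  have hf : (czL S * (1 + czA S)) v ∈ czCC E := by
    rw [Module.End.mul_apply]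
    exact czL_mem S ((czCC E).add_mem hv (czA_mem S hv))
  have hd := czd_mem (S j) hv
  let φ : ℝ → ℝ := fun t => (max t 0) ^ (p - 1) - (max (-t) 0) ^ (p - 1)
  have hφc : Continuous φ := by
    refine Continuous.sub ?_ ?_
    · exact Continuous.rpow_const (by fun_prop) (fun x => Or.inr (by linarith))
    · exact Continuous.rpow_const (by fun_prop) (fun x => Or.inr (by linarith))
  have hz : (0:ℝ) ^ (p - 1) = 0 := Real.zero_rpow (by linarith)
  have hφ0 : φ 0 = 0 := by simp [φ]
  have hφ1 : ∀ t, t * φ t = |t| ^ p := by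
    intro t
    rcases eq_or_ne t 0 with rfl | ht
    · simp [Real.zero_rpow hp0.ne']
    have e : |t| ^ p = |t| * |t| ^ (p - 1) := by
      have := Real.rpow_add_one (abs_pos.2 ht).ne' (p - 1)
      rw [mul_comm, ← this]; congr 1; ring
    rw [e]
    rcases le_total 0 t with h | h
    · simp only [φ]; rw [max_eq_left h, max_eq_right (by linarith), hz, abs_of_nonneg h]; ring
    · simp only [φ]; rw [max_eq_right h, max_eq_left (by linarith), hz, abs_of_nonpos h]; ring
  have hφ2 : ∀ t, |φ t| = |t| ^ (p - 1) := by
    intro t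
    rcases le_total 0 t with h | h
    · simp only [φ]; rw [max_eq_left h, max_eq_right (by linarith), hz, abs_of_nonneg h, sub_zero,
        abs_of_nonneg (by positivity)]
    · simp only [φ]; rw [max_eq_right h, max_eq_left (by linarith), hz, abs_of_nonpos h, zero_sub, abs_neg,
        abs_of_nonneg (Real.rpow_nonneg (by linarith) _)]
  have hφ3 : ∀ t, |s * φ t| ^ q = s ^ q * |t| ^ p := by
    intro t
    rw [abs_mul, abs_of_pos hs0, hφ2, Real.mul_rpow hs0.le (by positivity), ← Real.rpow_mul (abs_nonneg _),
      hpq.sub_one_mul_conj]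
  have hg : (fun x => s * φ (czd (S j) v x)) ∈ czCC E :=
    czCC_comp (φ := fun t => s * φ t) (by fun_prop) (by simp [hφ0]) hd
  have key := cz_discrete μ hB S j hv hg
  have ip : ∀ {u : E → ℝ}, u ∈ czCC E → Integrable (fun x => |u x| ^ p) μ := fun {u} hu =>
    cz_int μ (czCC_comp (φ := fun t => |t| ^ p)
      (Continuous.rpow_const (by fun_prop) (fun x => Or.inr hp0.le)) (by simp [Real.zero_rpow hp0.ne']) hu)
  have e1 : ∫ x, czd (S j) v x * (s * φ (czd (S j) v x)) ∂μ = s * ∫ x, |czd (S j) v x| ^ p ∂μ := by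
    rw [← integral_const_mul]
    congr 1; ext x; rw [← hφ1]; ring
  have e2 : ∫ x, B ((czL S * (1 + czA S)) v x, s * φ (czd (S j) v x)) ∂μ ≤
      C * (∫ x, |(czL S * (1 + czA S)) v x| ^ p ∂μ) + C * (s ^ q * ∫ x, |czd (S j) v x| ^ p ∂μ) := by
    rw [← integral_const_mul, ← integral_const_mul, ← integral_const_mul,
      ← integral_add ((ip hf).const_mul _) (((ip hd).const_mul _).const_mul _)]
    refine integral_mono (cz_int μ (hB.comp_mem hf hg)) (((ip hf).const_mul _).add
      (((ip hd).const_mul _).const_mul _)) (fun x => ?_)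
    refine (hBu _).trans (le_of_eq ?_)
    rw [hφ3]; ring
  rw [e1] at key
  have e3 := (le_abs_self _).trans key
  have e4 : 2 * (C * (s ^ q * ∫ x, |czd (S j) v x| ^ p ∂μ)) = s / 2 * ∫ x, |czd (S j) v x| ^ p ∂μ := by
    rw [← hsq]; ring
  rw [div_mul_eq_mul_div, le_div_iff₀ hs0]
  linarith

lemma cz_tr {P : ENNReal} (a : E) {f : E → ℝ} (hf : f ∈ czCC E) :
    eLpNorm (fun x => f (x + a)) P μ = eLpNorm f P μ :=
  eLpNorm_comp_measurePreserving (g := f) hf.1.aestronglyMeasurable (measurePreserving_add_right μ a)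

lemma czd_norm {P : ENNReal} (hP : 1 ≤ P) (a : E) {f : E → ℝ} (hf : f ∈ czCC E) :
    eLpNorm (czd a f) P μ ≤ 4 * eLpNorm f P μ := by
  have e : czd a f = ((fun x => f (x + a)) + (fun x => f (x + -a))) - (f + f) := by
    ext x; simp [czd_apply, sub_eq_add_neg]; ring
  have m1 : AEStronglyMeasurable f μ := hf.1.aestronglyMeasurable
  have m2 : ∀ b, AEStronglyMeasurable (fun x => f (x + b)) μ := fun b =>
    (hf.1.comp (continuous_add_const b)).aestronglyMeasurable
  rw [e]
  refine (eLpNorm_sub_le ((m2 _).add (m2 _)) (m1.add m1) hP).trans ?_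
  refine (add_le_add (eLpNorm_add_le (m2 _) (m2 _) hP) (eLpNorm_add_le m1 m1 hP)).trans ?_
  rw [cz_tr μ _ hf, cz_tr μ _ hf]
  apply le_of_eq; ring

lemma czA_norm [Nonempty ι] {P : ENNReal} (hP : 1 ≤ P) (S : ι → E) {f : E → ℝ} (hf : f ∈ czCC E) :
    eLpNorm ((1 + czA S) f) P μ ≤ 3 * eLpNorm f P μ := by
  have hN : (0:ℝ) < Fintype.card ι := by exact_mod_cast Fintype.card_pos
  have m1 : AEStronglyMeasurable f μ := hf.1.aestronglyMeasurable
  have e : (1 + czA S) f = (f + f) + (1 / (4 * (Fintype.card ι : ℝ))) • ∑ i, czd (S i) f := by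
    ext x
    simp only [czA, czL, LinearMap.add_apply, Pi.add_apply, Module.End.one_apply, LinearMap.smul_apply,
      Pi.smul_apply, LinearMap.sum_apply, add_assoc]
  have m3 : ∀ i, AEStronglyMeasurable (czd (S i) f) μ := fun i => (czd_mem (S i) hf).1.aestronglyMeasurable
  have m4 : AEStronglyMeasurable (∑ i, czd (S i) f) μ := Finset.aestronglyMeasurable_sum _ fun i _ => m3 i
  rw [e]
  refine (eLpNorm_add_le (m1.add m1) (m4.const_smul _) hP).trans ?_
  have h2 : eLpNorm ((1 / (4 * (Fintype.card ι : ℝ))) • ∑ i, czd (S i) f) P μ ≤ eLpNorm f P μ := by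
    rw [eLpNorm_const_smul]
    have h3 : eLpNorm (∑ i, czd (S i) f) P μ ≤ (Fintype.card ι : ENNReal) * (4 * eLpNorm f P μ) := by
      refine (eLpNorm_sum_le (fun i _ => m3 i) hP).trans ?_
      refine (Finset.sum_le_sum fun i _ => czd_norm μ hP (S i) hf).trans ?_
      simp
    refine (mul_le_mul_right h3 _).trans ?_
    have h4 : ‖(1 / (4 * (Fintype.card ι : ℝ)))‖ₑ * (Fintype.card ι * 4 : ENNReal) = 1 := by
      rw [Real.enorm_of_nonneg (by positivity)]
      have : (Fintype.card ι * 4 : ENNReal) = ENNReal.ofReal (Fintype.card ι * 4) := by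
        rw [ENNReal.ofReal_mul (by positivity)]; simp
      rw [this, ← ENNReal.ofReal_mul (by positivity)]
      rw [show 1 / (4 * (Fintype.card ι : ℝ)) * (Fintype.card ι * 4) = 1 by field_simp]
      simp
    rw [← mul_assoc, ← mul_assoc, mul_assoc ‖_‖ₑ, h4, one_mul]
  refine (add_le_add (eLpNorm_add_le m1 m1 hP) h2).trans (le_of_eq ?_)
  ring

lemma cz_disc_lp (p : ℝ) (hp : 1 < p) : ∃ C : ℝ, 0 < C ∧
    ∀ [Nonempty ι] (S : ι → E) (j : ι) (v : E → ℝ), v ∈ czCC E →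
      eLpNorm (czd (S j) v) (ENNReal.ofReal p) μ ≤ ENNReal.ofReal C * eLpNorm (czL S v) (ENNReal.ofReal p) μ := by
  obtain ⟨C, hC, h⟩ := cz_dual (ι := ι) μ p _ (Real.HolderConjugate.conjExponent hp)
  have hp0 : 0 < p := by linarith
  have hP : 1 ≤ ENNReal.ofReal p := by rw [← ENNReal.ofReal_one]; exact ENNReal.ofReal_le_ofReal hp.le
  refine ⟨C ^ (1 / p) * 3, by positivity, ?_⟩
  intro _ S j v hv
  have hL := czL_mem S hv
  have hf : (czL S * (1 + czA S)) v ∈ czCC E := by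
    rw [Module.End.mul_apply]
    exact czL_mem S ((czCC E).add_mem hv (czA_mem S hv))
  have e : ∀ {u : E → ℝ}, u ∈ czCC E → eLpNorm u (ENNReal.ofReal p) μ =
      ENNReal.ofReal ((∫ x, |u x| ^ p ∂μ) ^ (1 / p)) := fun {u} hu => by
    rw [(czCC_memLp μ hu (ENNReal.ofReal p)).eLpNorm_eq_integral_rpow_norm (by simpa using hp0) (by simp)]
    simp [ENNReal.toReal_ofReal hp0.le]
  have h1 : eLpNorm (czd (S j) v) (ENNReal.ofReal p) μ ≤ ENNReal.ofReal (C ^ (1 / p)) *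
      eLpNorm ((czL S * (1 + czA S)) v) (ENNReal.ofReal p) μ := by
    rw [e (czd_mem _ hv), e hf, ← ENNReal.ofReal_mul (by positivity)]
    apply ENNReal.ofReal_le_ofReal
    rw [← Real.mul_rpow hC.le (integral_nonneg fun x => by positivity)]
    exact Real.rpow_le_rpow (integral_nonneg fun x => by positivity) (h S j v hv) (by positivity)
  have h2 : (czL S * (1 + czA S)) v = (1 + czA S) (czL S v) := by
    rw [← Module.End.mul_apply]
    congr 1
    exact ((Commute.one_right _).add_right (czLA_comm S)).eq
  rw [h2] at h1
  refine h1.trans ?_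
  rw [ENNReal.ofReal_mul (by positivity), mul_assoc]
  refine mul_le_mul_right ?_ _
  simpa using czA_norm μ hP S hL
end flow4

section flow5
set_option linter.unusedSectionVars false
variable {E : Type*} [NormedAddCommGroup E] [NormedSpace ℝ E] [FiniteDimensional ℝ E]
  [MeasurableSpace E] [BorelSpace E]
variable {ι : Type*} [Fintype ι]
variable (μ : Measure E) [μ.IsAddHaarMeasure]

/-- Second directional derivative. -/
noncomputable def czH (v : E → ℝ) (a b x : E) : ℝ := fderiv ℝ (fun y => fderiv ℝ v y b) x a

lemma czH_eq {v : E → ℝ} {x : E} (hv : ContDiffAt ℝ 2 v x) (a b : E) :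
    czH v a b x = fderiv ℝ (fderiv ℝ v) x a b := by
  have h1 : DifferentiableAt ℝ (fderiv ℝ v) x :=
    (hv.fderiv_right (m := 1) (by norm_num)).differentiableAt (by norm_num)
  have := (h1.hasFDerivAt.clm_apply (hasFDerivAt_const b x)).fderiv
  simp [czH, this]

lemma czH_symm {v : E → ℝ} {x : E} (hv : ContDiffAt ℝ 2 v x) (a b : E) : czH v a b x = czH v b a x := by
  rw [czH_eq hv, czH_eq hv]
  exact (hv.isSymmSndFDerivAt (by simp)).eq a b

lemma czH_cont {v : E → ℝ} (hv : ContDiff ℝ 2 v) (a b : E) : Continuous (czH v a b) := by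
  have : czH v a b = fun x => fderiv ℝ (fderiv ℝ v) x a b := by
    ext x; exact czH_eq hv.contDiffAt a b
  rw [this]
  have h1 : ContDiff ℝ 0 (fderiv ℝ (fderiv ℝ v)) :=
    (hv.fderiv_right (m := 1) (by norm_num)).fderiv_right (m := 0) (by norm_num)
  exact (h1.continuous.clm_apply continuous_const).clm_apply continuous_const

lemma czH_mem {v : E → ℝ} (hv : ContDiff ℝ 2 v) (hc : HasCompactSupport v) (a b : E) : czH v a b ∈ czCC E :=
  ⟨czH_cont hv a b, (hc.fderiv_apply ℝ b).fderiv_apply ℝ a⟩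

lemma czH_mean {v : E → ℝ} (hv : ContDiff ℝ 2 v) (d x : E) {h : ℝ} (hh : 0 < h) :
    ∃ ξ ∈ Set.Ioo 0 h, czd (h • d) v x = h ^ 2 / 2 * (czH v d d (x + ξ • d) + czH v d d (x + (-ξ) • d)) := by
  let φ : ℝ → ℝ := fun t => v (x + t • d)
  let φ1 : ℝ → ℝ := fun t => fderiv ℝ v (x + t • d) d
  have hl : ∀ t : ℝ, HasDerivAt (fun t : ℝ => x + t • d) d t := fun t => by
    simpa using ((hasDerivAt_id t).smul_const d).const_add x
  have hφ : ∀ t, HasDerivAt φ (φ1 t) t := fun t =>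
    ((hv.differentiable (by norm_num)) (x + t • d)).hasFDerivAt.comp_hasDerivAt t (hl t)
  have hφ1 : ∀ t, HasDerivAt φ1 (czH v d d (x + t • d)) t := fun t => by
    have h2 : Differentiable ℝ (fun y => fderiv ℝ v y d) :=
      ((hv.fderiv_right (m := 1) (by norm_num)).clm_apply contDiff_const).differentiable (by norm_num)
    exact (h2 (x + t • d)).hasFDerivAt.comp_hasDerivAt t (hl t)
  have hneg : ∀ {f : ℝ → ℝ} {f' : ℝ → ℝ}, (∀ t, HasDerivAt f (f' t) t) → ∀ t, HasDerivAt (fun t => f (-t)) (-f' (-t)) t := by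
    intro f f' hf t
    have := (hf (-t)).comp t (hasDerivAt_neg t)
    rw [mul_neg_one] at this
    exact this
  have hG : ∀ t, HasDerivAt (fun t => φ t + φ (-t)) (φ1 t + -φ1 (-t)) t := fun t => (hφ t).add (hneg hφ t)
  have hG1 : ∀ t, HasDerivAt (fun t => φ1 t - φ1 (-t)) (czH v d d (x + t • d) - -czH v d d (x + (-t) • d)) t :=
    fun t => (hφ1 t).sub (hneg hφ1 t)
  have hS : ∀ t : ℝ, HasDerivAt (fun t : ℝ => t ^ 2) (2 * t) t := fun t => by
    simpa using hasDerivAt_pow 2 t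
  obtain ⟨c, hc, e⟩ := exists_ratio_hasDerivAt_eq_ratio_slope _ _ hh (fun t _ => (hG t).continuousAt.continuousWithinAt)
    (fun t _ => hG t) _ _ (fun t _ => (hS t).continuousAt.continuousWithinAt) (fun t _ => hS t)
  obtain ⟨ξ, hξ, e2⟩ := exists_hasDerivAt_eq_slope _ _ hc.1 (fun t _ => (hG1 t).continuousAt.continuousWithinAt)
    (fun t _ => hG1 t)
  refine ⟨ξ, ⟨hξ.1, hξ.2.trans hc.2⟩, ?_⟩
  have hc0 := hc.1
  rw [eq_div_iff (by linarith)] at e2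
  simp only [neg_zero, sub_self, sub_zero] at e e2
  have e3 : czd (h • d) v x = φ h + φ (-h) - 2 * φ 0 := by
    rw [czd_apply]; simp [φ, sub_eq_add_neg]
  rw [e3]
  have : (φ h + φ (-h) - 2 * φ 0) * (2 * c) = (h ^ 2 / 2 * (czH v d d (x + ξ • d) + czH v d d (x + (-ξ) • d))) * (2 * c) := by
    linear_combination -e - h ^ 2 * e2
  exact mul_right_cancel₀ (by positivity) this

lemma czH_lim {v : E → ℝ} (hv : ContDiff ℝ 2 v) (hc : HasCompactSupport v) (d : E) {p : ℝ} (hp : 1 < p) :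
    Filter.Tendsto (fun h : ℝ => eLpNorm (fun x => (h ^ 2)⁻¹ * czd (h • d) v x - czH v d d x) (ENNReal.ofReal p) μ)
      (nhdsWithin 0 (Set.Ioi 0)) (nhds 0) := by
  have hp0 : 0 < p := by linarith
  obtain ⟨R, hR⟩ := hc.isCompact.isBounded.subset_closedBall 0
  have hvz : ∀ x, R < ‖x‖ → v x = 0 := fun x hx => by
    apply image_eq_zero_of_notMem_tsupport
    intro hx2
    have := hR hx2
    simp at this; linarith
  have hHm := czH_mem hv hc d d
  have hHz : ∀ x, R < ‖x‖ → czH v d d x = 0 := fun x hx => by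
    apply image_eq_zero_of_notMem_tsupport
    intro hx2
    have h1 : x ∈ tsupport v := by
      refine tsupport_fderiv_subset ℝ (f := v) ?_
      have t1 : tsupport (czH v d d) ⊆ tsupport (fderiv ℝ (fun y => fderiv ℝ v y d)) := by
        apply closure_mono
        intro y hy hy2
        apply hy
        simp only [czH]; rw [hy2]; simp
      have t2 : tsupport (fun y => fderiv ℝ v y d) ⊆ tsupport (fderiv ℝ v) := by
        apply closure_mono
        intro y hy hy2
        apply hy
        simp only; rw [hy2]; simp
      exact t2 (tsupport_fderiv_subset ℝ (t1 hx2))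
    have := hR h1
    simp at this; linarith
  set K := Metric.closedBall (0:E) (R + ‖d‖) with hK
  have hμK : μ K < ⊤ := (isCompact_closedBall _ _).measure_lt_top
  have huc : UniformContinuous (czH v d d) := hHm.2.uniformContinuous_of_continuous hHm.1
  rw [Metric.uniformContinuous_iff] at huc
  have hbd : ∀ ε > 0, ∀ᶠ h in nhdsWithin (0:ℝ) (Set.Ioi 0),
      eLpNorm (fun x => (h ^ 2)⁻¹ * czd (h • d) v x - czH v d d x) (ENNReal.ofReal p) μ ≤
        μ K ^ (1 / p) * ENNReal.ofReal ε := by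
    intro ε hε
    obtain ⟨δ, hδ, hu⟩ := huc ε hε
    have hd1 : 0 < ‖d‖ + 1 := by positivity
    have hmem : Set.Ioo (0:ℝ) (min 1 (δ / (‖d‖ + 1))) ∈ nhdsWithin (0:ℝ) (Set.Ioi 0) :=
      Ioo_mem_nhdsGT (by positivity)
    filter_upwards [hmem] with h hh
    have h0 := hh.1
    have h1 : h < 1 := hh.2.trans_le (min_le_left _ _)
    have h2 : h * (‖d‖ + 1) < δ := by
      rw [← lt_div_iff₀ hd1]; exact hh.2.trans_le (min_le_right _ _)
    have hsupp : Function.support (fun x => (h ^ 2)⁻¹ * czd (h • d) v x - czH v d d x) ⊆ K := by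
      intro x hx
      by_contra hxK
      apply hx
      have hx1 : R + ‖d‖ < ‖x‖ := by simpa [hK] using hxK
      have hn : ‖h • d‖ ≤ ‖d‖ := by
        rw [norm_smul, Real.norm_of_nonneg h0.le]
        nlinarith [norm_nonneg d]
      have n1 : R < ‖x + h • d‖ := by
        have := norm_sub_norm_le x (-(h • d)); rw [sub_neg_eq_add, norm_neg] at this; linarith
      have n2 : R < ‖x - h • d‖ := by
        have := norm_sub_norm_le x (h • d); linarith
      have n3 : R < ‖x‖ := by linarith [norm_nonneg d]
      simp only
      rw [czd_apply, hvz _ n1, hvz _ n2, hvz _ n3, hHz _ n3]; simp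
    rw [← eLpNorm_restrict_eq_of_support_subset hsupp]
    have := eLpNorm_le_of_ae_bound (p := ENNReal.ofReal p) (μ := μ.restrict K) (C := ε)
      (f := fun x => (h ^ 2)⁻¹ * czd (h • d) v x - czH v d d x) (Filter.Eventually.of_forall fun x => by
        obtain ⟨ξ, hξ, e⟩ := czH_mean hv d x h0
        have b : ∀ t : ℝ, |t| < h → |czH v d d (x + t • d) - czH v d d x| < ε := fun t ht => by
          have := hu (a := x + t • d) (b := x) (by
            rw [dist_eq_norm, add_sub_cancel_left, norm_smul, Real.norm_eq_abs]
            nlinarith [norm_nonneg d, abs_nonneg t])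
          simpa [Real.dist_eq] using this
        have b1 := abs_lt.1 (b ξ (by rw [abs_of_pos hξ.1]; exact hξ.2))
        have b2 := abs_lt.1 (b (-ξ) (by rw [abs_neg, abs_of_pos hξ.1]; exact hξ.2))
        rw [e, Real.norm_eq_abs, show (h ^ 2)⁻¹ * (h ^ 2 / 2 * (czH v d d (x + ξ • d) + czH v d d (x + (-ξ) • d))) =
          (czH v d d (x + ξ • d) + czH v d d (x + (-ξ) • d)) / 2 by field_simp, abs_le]
        constructor <;> linarith)
    simpa [ENNReal.toReal_ofReal hp0.le] using this
  rw [ENNReal.tendsto_nhds_zero]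
  intro ε hε
  have hM : μ K ^ (1 / p) ≠ ⊤ := ENNReal.rpow_ne_top_of_nonneg (by positivity) hμK.ne
  by_cases hεt : ε = ⊤
  · simp [hεt]
  set M := (μ K ^ (1 / p)).toReal with hMd
  have hM0 : 0 ≤ M := ENNReal.toReal_nonneg
  have hεr : 0 < ε.toReal := ENNReal.toReal_pos hε.ne' hεt
  filter_upwards [hbd (ε.toReal / (M + 1)) (by positivity)] with h hh
  refine hh.trans ?_
  rw [← ENNReal.ofReal_toReal hM, ← hMd, ← ENNReal.ofReal_mul hM0, ← ENNReal.ofReal_toReal hεt]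
  apply ENNReal.ofReal_le_ofReal
  rw [ENNReal.toReal_ofReal hεr.le, mul_div_assoc', div_le_iff₀ (by positivity)]
  nlinarith

lemma cz_global_dir (p : ℝ) (hp : 1 < p) : ∃ C : ℝ, 0 < C ∧
    ∀ [Nonempty ι] (S : ι → E) (j : ι) (v : E → ℝ), ContDiff ℝ 2 v → HasCompactSupport v →
      eLpNorm (czH v (S j) (S j)) (ENNReal.ofReal p) μ ≤
        ENNReal.ofReal C * eLpNorm (fun x => ∑ i, czH v (S i) (S i) x) (ENNReal.ofReal p) μ := by
  obtain ⟨C, hC, hd⟩ := cz_disc_lp (ι := ι) μ p hp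
  have hP : 1 ≤ ENNReal.ofReal p := by rw [← ENNReal.ofReal_one]; exact ENNReal.ofReal_le_ofReal hp.le
  refine ⟨C, hC, ?_⟩
  intro _ S j v hv hc
  have hvm : v ∈ czCC E := ⟨hv.continuous, hc⟩
  set e : ι → ℝ → ENNReal := fun i h => eLpNorm (fun x => (h ^ 2)⁻¹ * czd (h • S i) v x - czH v (S i) (S i) x)
    (ENNReal.ofReal p) μ with he
  have hlim : ∀ i, Filter.Tendsto (e i) (nhdsWithin 0 (Set.Ioi 0)) (nhds 0) := fun i => czH_lim μ hv hc (S i) hp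
  have m1 : ∀ i, AEStronglyMeasurable (czH v (S i) (S i)) μ := fun i => (czH_cont hv _ _).aestronglyMeasurable
  have m2 : ∀ i (h : ℝ), AEStronglyMeasurable (fun x => (h ^ 2)⁻¹ * czd (h • S i) v x) μ := fun i h =>
    ((czd_mem (h • S i) hvm).1.const_mul _).aestronglyMeasurable
  have main : ∀ h : ℝ, eLpNorm (czH v (S j) (S j)) (ENNReal.ofReal p) μ ≤ e j h + ENNReal.ofReal C *
      (∑ i, e i h + eLpNorm (fun x => ∑ i, czH v (S i) (S i) x) (ENNReal.ofReal p) μ) := by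
    intro h
    have e1 : czH v (S j) (S j) = (fun x => (h ^ 2)⁻¹ * czd (h • S j) v x) -
        (fun x => (h ^ 2)⁻¹ * czd (h • S j) v x - czH v (S j) (S j) x) := by
      ext x; simp
    have t1 : eLpNorm (czH v (S j) (S j)) (ENNReal.ofReal p) μ ≤
        eLpNorm (fun x => (h ^ 2)⁻¹ * czd (h • S j) v x) (ENNReal.ofReal p) μ + e j h := by
      conv_lhs => rw [e1]
      exact eLpNorm_sub_le (m2 j h) ((m2 j h).sub (m1 j)) hP
    have t2 : eLpNorm (fun x => (h ^ 2)⁻¹ * czd (h • S j) v x) (ENNReal.ofReal p) μ ≤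
        ENNReal.ofReal C * eLpNorm (fun x => (h ^ 2)⁻¹ * czL (fun i => h • S i) v x) (ENNReal.ofReal p) μ := by
      have s1 : ∀ f : E → ℝ, eLpNorm (fun x => (h ^ 2)⁻¹ * f x) (ENNReal.ofReal p) μ = ‖(h ^ 2)⁻¹‖ₑ *
        eLpNorm f (ENNReal.ofReal p) μ := fun f => eLpNorm_const_smul ((h ^ 2)⁻¹) f _ _
      rw [s1, s1, mul_left_comm]
      exact mul_le_mul_right (hd (fun i => h • S i) j v hvm) _
    have e2 : (fun x => (h ^ 2)⁻¹ * czL (fun i => h • S i) v x) =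
        (∑ i, fun x => (h ^ 2)⁻¹ * czd (h • S i) v x - czH v (S i) (S i) x) + (fun x => ∑ i, czH v (S i) (S i) x) := by
      ext x
      simp [czL, Finset.mul_sum]
    have m3 : AEStronglyMeasurable (fun x => ∑ i, czH v (S i) (S i) x) μ :=
      (continuous_finsetSum _ fun i _ => czH_cont hv _ _).aestronglyMeasurable
    have m4 : AEStronglyMeasurable (∑ i, fun x => (h ^ 2)⁻¹ * czd (h • S i) v x - czH v (S i) (S i) x) μ :=
      Finset.aestronglyMeasurable_sum _ fun i _ => (m2 i h).sub (m1 i)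
    have t3 : eLpNorm (fun x => (h ^ 2)⁻¹ * czL (fun i => h • S i) v x) (ENNReal.ofReal p) μ ≤
        ∑ i, e i h + eLpNorm (fun x => ∑ i, czH v (S i) (S i) x) (ENNReal.ofReal p) μ := by
      rw [e2]
      refine (eLpNorm_add_le m4 m3 hP).trans (add_le_add ?_ le_rfl)
      exact eLpNorm_sum_le (fun i _ => (m2 i h).sub (m1 i)) hP
    refine t1.trans ?_
    rw [add_comm]
    exact add_le_add le_rfl (t2.trans (mul_le_mul_right t3 _))
  have hT : Filter.Tendsto (fun h => e j h + ENNReal.ofReal C *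
      (∑ i, e i h + eLpNorm (fun x => ∑ i, czH v (S i) (S i) x) (ENNReal.ofReal p) μ)) (nhdsWithin 0 (Set.Ioi 0))
      (nhds (0 + ENNReal.ofReal C * (∑ _i : ι, 0 + eLpNorm (fun x => ∑ i, czH v (S i) (S i) x) (ENNReal.ofReal p) μ))) := by
    refine (hlim j).add (ENNReal.Tendsto.const_mul ?_ (Or.inr ENNReal.ofReal_ne_top))
    exact (tendsto_finsetSum _ fun i _ => hlim i).add tendsto_const_nhds
  have := ge_of_tendsto' hT main
  simpa using this
end flow5

section flow6

lemma cz_global (n : ℕ) (p : ℝ) (hp : 1 < p) : ∃ C : ℝ, 0 < C ∧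
    ∀ (v : EuclideanSpace ℝ (Fin n) → ℝ), ContDiff ℝ 2 v → HasCompactSupport v → ∀ i j : Fin n,
      eLpNorm (pd2 v i j) (ENNReal.ofReal p) volume ≤
        ENNReal.ofReal C * eLpNorm (lap v) (ENNReal.ofReal p) volume := by
  obtain ⟨C, hC, h⟩ := cz_global_dir (E := EuclideanSpace ℝ (Fin n)) (ι := Fin n × Fin n × Bool) volume p hp
  have hP : 1 ≤ ENNReal.ofReal p := by rw [← ENNReal.ofReal_one]; exact ENNReal.ofReal_le_ofReal hp.le
  refine ⟨C * (4 * n) + 1, by positivity, ?_⟩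
  intro v hv hc i j
  have : Nonempty (Fin n × Fin n × Bool) := ⟨(i, j, true)⟩
  let e : Fin n → EuclideanSpace ℝ (Fin n) := fun i => EuclideanSpace.single i 1
  let S : Fin n × Fin n × Bool → EuclideanSpace ℝ (Fin n) := fun k => e k.1 + (if k.2.2 then (1:ℝ) else -1) • e k.2.1
  have hpd : ∀ i j x, pd2 v i j x = fderiv ℝ (fderiv ℝ v) x (e i) (e j) := fun i j x =>
    czH_eq hv.contDiffAt (e i) (e j)
  have hsy : ∀ i j x, fderiv ℝ (fderiv ℝ v) x (e i) (e j) = fderiv ℝ (fderiv ℝ v) x (e j) (e i) := fun i j x => by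
    rw [← czH_eq hv.contDiffAt, ← czH_eq hv.contDiffAt, czH_symm hv.contDiffAt]
  have hHt : ∀ i j x, czH v (S (i, j, true)) (S (i, j, true)) x = pd2 v i i x + 2 * pd2 v i j x + pd2 v j j x := by
    intro i j x
    rw [czH_eq hv.contDiffAt, hpd, hpd, hpd]
    simp [S]
    rw [hsy j i x]; ring
  have hHf : ∀ i j x, czH v (S (i, j, false)) (S (i, j, false)) x = pd2 v i i x - 2 * pd2 v i j x + pd2 v j j x := by
    intro i j x
    rw [czH_eq hv.contDiffAt, hpd, hpd, hpd]
    simp [S]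
    rw [hsy j i x]; ring
  have hsum : (fun x => ∑ k, czH v (S k) (S k) x) = (4 * n : ℝ) • lap v := by
    ext x
    rw [Fintype.sum_prod_type]
    simp_rw [Fintype.sum_prod_type, Fintype.sum_bool, hHt, hHf]
    simp only [lap, Pi.smul_apply, smul_eq_mul]
    have : ∀ a b : Fin n, pd2 v a a x + 2 * pd2 v a b x + pd2 v b b x + (pd2 v a a x - 2 * pd2 v a b x + pd2 v b b x)
      = 2 * pd2 v a a x + 2 * pd2 v b b x := fun a b => by ring
    simp_rw [this, Finset.sum_add_distrib, ← Finset.mul_sum]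
    simp [← Finset.mul_sum]
    ring
  have hij : pd2 v i j = (1/4 : ℝ) • (czH v (S (i, j, true)) (S (i, j, true)) - czH v (S (i, j, false)) (S (i, j, false))) := by
    ext x
    simp only [Pi.smul_apply, Pi.sub_apply, hHt, hHf, smul_eq_mul]; ring
  have hb : ∀ k, eLpNorm (czH v (S k) (S k)) (ENNReal.ofReal p) volume ≤
      ENNReal.ofReal (C * (4 * n)) * eLpNorm (lap v) (ENNReal.ofReal p) volume := by
    intro k
    have := h S k v hv hc
    rw [hsum, eLpNorm_const_smul, ← mul_assoc, Real.enorm_of_nonneg (by positivity), ← ENNReal.ofReal_mul hC.le] at this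
    exact this
  rw [hij, eLpNorm_const_smul]
  have h4 : ‖(1/4:ℝ)‖ₑ * 2 ≤ 1 := by
    rw [Real.enorm_of_nonneg (by norm_num), show (2:ENNReal) = ENNReal.ofReal 2 by simp,
      ← ENNReal.ofReal_mul (by norm_num), ← ENNReal.ofReal_one]
    exact ENNReal.ofReal_le_ofReal (by norm_num)
  refine (mul_le_mul_right ((eLpNorm_sub_le (czH_cont hv _ _).aestronglyMeasurable
    (czH_cont hv _ _).aestronglyMeasurable hP).trans (add_le_add (hb _) (hb _))) _).trans ?_
  rw [← two_mul, ← mul_assoc]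
  refine (mul_le_mul_left h4 _).trans ?_
  rw [one_mul]
  exact mul_le_mul_left (ENNReal.ofReal_le_ofReal (by linarith)) _

variable {E : Type*} [NormedAddCommGroup E] [NormedSpace ℝ E] [FiniteDimensional ℝ E]
  [MeasurableSpace E] [BorelSpace E] (μ : Measure E) [μ.IsAddHaarMeasure]

lemma cz_mink {g : E → ℝ} (hg : Continuous g) (a : E) (p : ℝ) (hp : 1 < p) :
    eLpNorm (fun x => ∫ s in (0:ℝ)..1, |g (x + s • a)|) (ENNReal.ofReal p) μ ≤ eLpNorm g (ENNReal.ofReal p) μ := by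
  have hp0 : 0 < p := by linarith
  have hP : 1 ≤ ENNReal.ofReal p := by rw [← ENNReal.ofReal_one]; exact ENNReal.ofReal_le_ofReal hp.le
  have hP0 : ENNReal.ofReal p ≠ 0 := by simpa using hp0
  rw [eLpNorm_eq_lintegral_rpow_enorm_toReal hP0 (by simp), eLpNorm_eq_lintegral_rpow_enorm_toReal hP0 (by simp),
    ENNReal.toReal_ofReal hp0.le]
  refine ENNReal.rpow_le_rpow ?_ (by positivity)
  set ν := (volume : Measure ℝ).restrict (Set.Ioc 0 1) with hν
  have : IsProbabilityMeasure ν := ⟨by simp [hν]⟩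
  have h1 : ∀ x, ‖∫ s in (0:ℝ)..1, |g (x + s • a)|‖ₑ ^ p ≤ ∫⁻ s, ‖g (x + s • a)‖ₑ ^ p ∂ν := by
    intro x
    have hgc : Continuous (fun s : ℝ => g (x + s • a)) := by fun_prop
    have a1 : ‖∫ s in (0:ℝ)..1, |g (x + s • a)|‖ₑ ≤ eLpNorm (fun s : ℝ => g (x + s • a)) 1 ν := by
      rw [intervalIntegral.integral_of_le (by norm_num), eLpNorm_one_eq_lintegral_enorm]
      refine (enorm_integral_le_lintegral_enorm _).trans (le_of_eq ?_)
      simp [hν]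
    have a2 := a1.trans (eLpNorm_le_eLpNorm_of_exponent_le hP hgc.aestronglyMeasurable)
    rw [eLpNorm_eq_lintegral_rpow_enorm_toReal hP0 (by simp), ENNReal.toReal_ofReal hp0.le] at a2
    refine (ENNReal.rpow_le_rpow a2 hp0.le).trans (le_of_eq ?_)
    rw [← ENNReal.rpow_mul, one_div_mul_cancel hp0.ne', ENNReal.rpow_one]
  refine (lintegral_mono h1).trans ?_
  rw [lintegral_lintegral_swap]
  · have : ∀ s : ℝ, ∫⁻ x, ‖g (x + s • a)‖ₑ ^ p ∂μ = ∫⁻ x, ‖g x‖ₑ ^ p ∂μ := fun s =>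
      lintegral_add_right_eq_self (fun x => ‖g x‖ₑ ^ p) (s • a)
    simp_rw [this]
    simp
  · apply Measurable.aemeasurable
    have : Continuous (fun z : E × ℝ => g (z.1 + z.2 • a)) := by fun_prop
    exact this.measurable.enorm.pow_const p

lemma cz_taylor {w : E → ℝ} (hw : ContDiff ℝ 2 w) (e x : E) {ε : ℝ} (hε : 0 < ε) :
    |fderiv ℝ w x e| ≤ ε⁻¹ * (|w (x + ε • e)| + |w x|) + ε * ∫ s in (0:ℝ)..1, |czH w e e (x + s • (ε • e))| := by
  let φ : ℝ → ℝ := fun t => w (x + t • (ε • e))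
  let φ1 : ℝ → ℝ := fun t => ε * fderiv ℝ w (x + t • (ε • e)) e
  let φ2 : ℝ → ℝ := fun t => ε * (ε * czH w e e (x + t • (ε • e)))
  have hl : ∀ t : ℝ, HasDerivAt (fun t : ℝ => x + t • (ε • e)) (ε • e) t := fun t => by
    simpa using ((hasDerivAt_id t).smul_const (ε • e)).const_add x
  have hφ : ∀ t, HasDerivAt φ (φ1 t) t := fun t => by
    have := ((hw.differentiable (by norm_num)) (x + t • (ε • e))).hasFDerivAt.comp_hasDerivAt t (hl t)
    rw [map_smul, smul_eq_mul] at this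
    exact this
  have hφ1 : ∀ t, HasDerivAt φ1 (φ2 t) t := fun t => by
    have h2 : Differentiable ℝ (fun y => fderiv ℝ w y e) :=
      ((hw.fderiv_right (m := 1) (by norm_num)).clm_apply contDiff_const).differentiable (by norm_num)
    have := ((h2 (x + t • (ε • e))).hasFDerivAt.comp_hasDerivAt t (hl t)).const_mul ε
    rw [map_smul, smul_eq_mul] at this
    exact this
  have hc2 : Continuous φ2 := by
    have := czH_cont hw e e
    fun_prop
  have hψ : ∀ t, HasDerivAt (fun t => φ t + (1 - t) * φ1 t) ((1 - t) * φ2 t) t := fun t => by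
    have := (hφ t).add ((((hasDerivAt_id t).const_sub 1)).mul (hφ1 t))
    rw [show φ1 t + (-1 * φ1 t + (1 - id t) * φ2 t) = (1 - t) * φ2 t by simp only [id]; ring] at this
    exact this
  have hft := intervalIntegral.integral_eq_sub_of_hasDerivAt (a := 0) (b := 1) (fun t _ => hψ t)
    (Continuous.intervalIntegrable (by fun_prop) _ _)
  have hbd : |∫ t in (0:ℝ)..1, (1 - t) * φ2 t| ≤ ε * (ε * ∫ s in (0:ℝ)..1, |czH w e e (x + s • (ε • e))|) := by
    rw [← intervalIntegral.integral_const_mul, ← intervalIntegral.integral_const_mul]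
    refine (intervalIntegral.abs_integral_le_integral_abs (by norm_num)).trans ?_
    have hcH := czH_cont hw e e
    refine intervalIntegral.integral_mono_on (by norm_num) (Continuous.intervalIntegrable (by fun_prop) _ _)
      (Continuous.intervalIntegrable (by fun_prop) _ _) (fun t ht => ?_)
    simp only [φ2]
    rw [abs_mul, abs_mul, abs_mul, abs_of_pos hε]
    have : |1 - t| ≤ 1 := abs_le.2 ⟨by linarith [ht.2], by linarith [ht.1]⟩
    exact mul_le_of_le_one_left (by positivity) this
  simp [φ, φ1] at hft
  rw [hft] at hbd
  have h3 : ε * |fderiv ℝ w x e| ≤ |w (x + ε • e)| + |w x| + ε * (ε * ∫ s in (0:ℝ)..1, |czH w e e (x + s • (ε • e))|) := by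
    rw [← abs_of_pos hε, ← abs_mul, abs_of_pos hε]
    have := abs_add_three (w (x + ε • e)) (-(w x)) (-(w (x + ε • e) - (w x + ε * fderiv ℝ w x e)))
    rw [abs_neg, abs_neg] at this
    have h4 : w (x + ε • e) + -(w x) + -(w (x + ε • e) - (w x + ε * fderiv ℝ w x e)) = ε * fderiv ℝ w x e := by ring
    rw [h4] at this
    linarith
  rw [← mul_le_mul_iff_right₀ hε]
  refine h3.trans (le_of_eq ?_)
  field_simp

lemma cz_interp {w : E → ℝ} (hw : ContDiff ℝ 2 w) (hc : HasCompactSupport w) (e : E) {ε : ℝ} (hε : 0 < ε)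
    (p : ℝ) (hp : 1 < p) :
    eLpNorm (fun x => fderiv ℝ w x e) (ENNReal.ofReal p) μ ≤ ENNReal.ofReal (2 * ε⁻¹) * eLpNorm w (ENNReal.ofReal p) μ +
      ENNReal.ofReal ε * eLpNorm (czH w e e) (ENNReal.ofReal p) μ := by
  have hP : 1 ≤ ENNReal.ofReal p := by rw [← ENNReal.ofReal_one]; exact ENNReal.ofReal_le_ofReal hp.le
  have hwm : w ∈ czCC E := ⟨hw.continuous, hc⟩
  have hcw := hw.continuous
  have hcH := czH_cont hw e e
  set J : E → ℝ := fun x => ∫ s in (0:ℝ)..1, |czH w e e (x + s • (ε • e))| with hJ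
  have hJc : Continuous J := by
    apply intervalIntegral.continuous_parametric_intervalIntegral_of_continuous'
    simp only [Function.uncurry_def]
    fun_prop
  have h1 : eLpNorm (fun x => fderiv ℝ w x e) (ENNReal.ofReal p) μ ≤
      eLpNorm (ε⁻¹ • ((fun x => ‖w (x + ε • e)‖) + (fun x => ‖w x‖)) + ε • J) (ENNReal.ofReal p) μ := by
    refine eLpNorm_mono_real fun x => ?_
    exact cz_taylor hw e x hε
  refine h1.trans ?_
  have m1 : Continuous fun x => ‖w (x + ε • e)‖ := by fun_prop
  have m2 : Continuous fun x => ‖w x‖ := by fun_prop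
  refine (eLpNorm_add_le ((m1.add m2).const_smul ε⁻¹).aestronglyMeasurable (hJc.const_smul ε).aestronglyMeasurable hP).trans ?_
  rw [eLpNorm_const_smul, eLpNorm_const_smul, Real.enorm_of_nonneg hε.le, Real.enorm_of_nonneg (inv_pos.2 hε).le]
  refine add_le_add ?_ (mul_le_mul_right (cz_mink μ hcH (ε • e) p hp) _)
  have h2 := eLpNorm_add_le (μ := μ) m1.aestronglyMeasurable m2.aestronglyMeasurable hP
  rw [eLpNorm_norm w, eLpNorm_norm (fun x => w (x + ε • e)), cz_tr μ _ hwm, ← two_mul] at h2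
  refine (mul_le_mul_right h2 _).trans (le_of_eq ?_)
  rw [ENNReal.ofReal_mul (by norm_num)]
  simp; ring
end flow6

section loc1

lemma cz_iter (l : ℕ → ℝ) (D H G : ℝ) (hD : 0 ≤ D) (hrec : ∀ k, l k ≤ 1 / 8 * l (k + 1) + D + 4 ^ k * H)
    (hgr : ∀ k, l k ≤ G * 4 ^ k) (hH : 0 ≤ H) : l 0 ≤ 2 * D + 2 * H := by
  have key : ∀ m k : ℕ, l k ≤ 2 * D + 2 * H * 4 ^ k + G * 4 ^ k * (1 / 2) ^ m := by
    intro m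
    induction m with
    | zero => intro k; have := hgr k; have h4 : (0:ℝ) < 4 ^ k := by positivity
              have : 0 ≤ H * 4 ^ k := by positivity
              simp; linarith
    | succ m ih =>
      intro k
      have h1 := hrec k
      have h2 := ih (k + 1)
      have e : (4:ℝ) ^ (k + 1) = 4 * 4 ^ k := by ring
      have e2 : (1 / 2 : ℝ) ^ (m + 1) = 1 / 2 * (1 / 2) ^ m := by ring
      rw [e] at h2; rw [e2]
      linarith
  have ht : Filter.Tendsto (fun m : ℕ => 2 * D + 2 * H + G * (1 / 2 : ℝ) ^ m) Filter.atTop (nhds (2 * D + 2 * H + G * 0)) :=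
    ((tendsto_pow_atTop_nhds_zero_of_lt_one (by norm_num) (by norm_num)).const_mul G).const_add _
  have := ge_of_tendsto' ht (fun m => by have := key m 0; simpa using this)
  simpa using this

lemma cz_sig_zero {t : ℝ} (ht : t ∉ Set.Icc (0:ℝ) 1) :
    deriv Real.smoothTransition t = 0 ∧ deriv (deriv Real.smoothTransition) t = 0 := by
  have hev : ∃ c : ℝ, ∀ᶠ s in nhds t, Real.smoothTransition s = c := by
    rw [Set.mem_Icc, not_and_or, not_le, not_le] at ht
    rcases ht with ht | ht
    · exact ⟨0, by filter_upwards [gt_mem_nhds ht] with s hs using Real.smoothTransition.zero_of_nonpos hs.le⟩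
    · exact ⟨1, by filter_upwards [lt_mem_nhds ht] with s hs using Real.smoothTransition.one_of_one_le hs.le⟩
  obtain ⟨c, hc⟩ := hev
  have hc1 : Real.smoothTransition =ᶠ[nhds t] fun _ => c := hc
  have h1 : deriv Real.smoothTransition =ᶠ[nhds t] fun _ => 0 := by
    have := hc1.deriv
    simpa using this
  refine ⟨h1.eq_of_nhds, ?_⟩
  have := h1.deriv_eq
  simpa using this

lemma cz_sig_bound : ∃ M : ℝ, 0 < M ∧ ∀ t, |deriv Real.smoothTransition t| ≤ M ∧
    |deriv (deriv Real.smoothTransition) t| ≤ M := by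
  have hs : ContDiff ℝ 2 Real.smoothTransition := Real.smoothTransition.contDiff
  have h1 : ContDiff ℝ 1 (deriv Real.smoothTransition) := by
    have : ContDiff ℝ (1 + 1) Real.smoothTransition := hs.of_le (by norm_num)
    exact (contDiff_succ_iff_deriv.1 this).2.2
  have h2 : Continuous (deriv (deriv Real.smoothTransition)) := h1.continuous_deriv (by norm_num)
  obtain ⟨M1, hM1⟩ := isCompact_Icc.exists_bound_of_continuousOn (s := Set.Icc (0:ℝ) 1) h1.continuous.continuousOn
  obtain ⟨M2, hM2⟩ := isCompact_Icc.exists_bound_of_continuousOn (s := Set.Icc (0:ℝ) 1) h2.continuousOn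
  refine ⟨max 1 (max M1 M2), by positivity, fun t => ?_⟩
  by_cases ht : t ∈ Set.Icc (0:ℝ) 1
  · exact ⟨(hM1 t ht).trans (by simp), (hM2 t ht).trans (by simp)⟩
  · rw [(cz_sig_zero ht).1, (cz_sig_zero ht).2]; simp

variable {n : ℕ}

/-- Cutoff functions. -/
noncomputable def czX (n : ℕ) (lam rho : ℝ) (x : EuclideanSpace ℝ (Fin n)) : ℝ :=
  Real.smoothTransition (lam * (rho - ‖x‖ ^ 2))

lemma czX_contDiff (lam rho : ℝ) (m : ℕ∞) : ContDiff ℝ m (czX n lam rho) := by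
  have h1 : ContDiff ℝ m (fun x : EuclideanSpace ℝ (Fin n) => lam * (rho - ‖x‖ ^ 2)) :=
    contDiff_const.mul (contDiff_const.sub (contDiff_norm_sq ℝ))
  exact Real.smoothTransition.contDiff.comp h1

lemma cz_g_deriv (lam rho : ℝ) (x : EuclideanSpace ℝ (Fin n)) :
    HasFDerivAt (fun x : EuclideanSpace ℝ (Fin n) => lam * (rho - ‖x‖ ^ 2)) (lam • -((2 • innerSL ℝ x : EuclideanSpace ℝ (Fin n) →L[ℝ] ℝ))) x :=
  ((hasStrictFDerivAt_norm_sq x).hasFDerivAt.const_sub rho).const_mul lam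

lemma czX_pd (lam rho : ℝ) (i : Fin n) (x : EuclideanSpace ℝ (Fin n)) :
    pd (czX n lam rho) i x = deriv Real.smoothTransition (lam * (rho - ‖x‖ ^ 2)) * (-(2 * lam) * x i) := by
  have hs : Differentiable ℝ Real.smoothTransition :=
    (Real.smoothTransition.contDiff (n := 1)).differentiable (by norm_num)
  have := (hs (lam * (rho - ‖x‖ ^ 2))).hasDerivAt.comp_hasFDerivAt (f := fun x => lam * (rho - ‖x‖ ^ 2)) x (cz_g_deriv lam rho x)
  have h2 := this.fderiv
  rw [pd, show czX n lam rho = Real.smoothTransition ∘ fun x => lam * (rho - ‖x‖ ^ 2) from rfl, h2]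
  simp [EuclideanSpace.inner_single_right]
  left; ring

lemma czX_pd2 (lam rho : ℝ) (i : Fin n) (x : EuclideanSpace ℝ (Fin n)) :
    pd2 (czX n lam rho) i i x = deriv (deriv Real.smoothTransition) (lam * (rho - ‖x‖ ^ 2)) * (2 * lam * x i) ^ 2
      - deriv Real.smoothTransition (lam * (rho - ‖x‖ ^ 2)) * (2 * lam) := by
  have hs : ContDiff ℝ 2 Real.smoothTransition := Real.smoothTransition.contDiff
  have h1 : ContDiff ℝ 1 (deriv Real.smoothTransition) := by
    have : ContDiff ℝ (1 + 1) Real.smoothTransition := hs.of_le (by norm_num)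
    exact (contDiff_succ_iff_deriv.1 this).2.2
  have a1 := ((h1.differentiable (by norm_num)) (lam * (rho - ‖x‖ ^ 2))).hasDerivAt.comp_hasFDerivAt (f := fun x => lam * (rho - ‖x‖ ^ 2)) x
    (cz_g_deriv lam rho x)
  have a2 : HasFDerivAt (fun y : EuclideanSpace ℝ (Fin n) => -(2 * lam) * y i)
      (-(2 * lam) • (EuclideanSpace.proj i : EuclideanSpace ℝ (Fin n) →L[ℝ] ℝ)) x :=
    (EuclideanSpace.proj i : EuclideanSpace ℝ (Fin n) →L[ℝ] ℝ).hasFDerivAt.const_mul _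
  have h2 := (a1.mul a2).fderiv
  have e : pd (czX n lam rho) i = (deriv Real.smoothTransition ∘ fun x => lam * (rho - ‖x‖ ^ 2)) *
      (fun y : EuclideanSpace ℝ (Fin n) => -(2 * lam) * y i) := by
    ext y; rw [czX_pd]; rfl
  rw [pd2, pd, e, h2]
  simp [EuclideanSpace.inner_single_right]
  ring

lemma czX_bound : ∃ M : ℝ, 0 < M ∧ ∀ (n : ℕ) (lam rho : ℝ), 1 ≤ lam → rho ≤ 3 → ∀ (i : Fin n) x,
    |pd (czX n lam rho) i x| ≤ M * lam ∧ |pd2 (czX n lam rho) i i x| ≤ M * lam ^ 2 := by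
  obtain ⟨M, hM, hb⟩ := cz_sig_bound
  refine ⟨18 * M, by positivity, ?_⟩
  intro n lam rho hl hr i x
  rw [czX_pd, czX_pd2]
  by_cases ht : lam * (rho - ‖x‖ ^ 2) ∈ Set.Icc (0:ℝ) 1
  · have h1 : ‖x‖ ^ 2 ≤ 3 := by
      have : 0 ≤ rho - ‖x‖ ^ 2 := by
        by_contra hcon
        push Not at hcon
        have := mul_neg_of_pos_of_neg (by linarith : 0 < lam) hcon
        linarith [ht.1]
      linarith
    have h2 : |x i| ^ 2 ≤ 4 := by
      have h3 : |x i| ≤ ‖x‖ := PiLp.norm_apply_le x i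
      nlinarith [abs_nonneg (x i)]
    have h3 : |x i| ≤ 2 := by nlinarith [abs_nonneg (x i)]
    obtain ⟨b1, b2⟩ := hb (lam * (rho - ‖x‖ ^ 2))
    have hl0 : 0 < lam := by linarith
    constructor
    · rw [abs_mul, abs_mul, abs_neg, abs_of_pos (by positivity : 0 < 2 * lam)]
      calc _ ≤ M * (2 * lam * 2) := by gcongr
        _ ≤ _ := by nlinarith
    · refine (abs_sub _ _).trans ?_
      rw [abs_mul, abs_mul, abs_pow, abs_mul (2 * lam), mul_pow, abs_of_pos (by positivity : 0 < 2 * lam)]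
      calc _ ≤ M * ((2 * lam) ^ 2 * 4) + M * (2 * lam) := by gcongr
        _ ≤ _ := by nlinarith [mul_pos hM hl0]
  · rw [(cz_sig_zero ht).1, (cz_sig_zero ht).2]
    simp
    constructor <;> positivity

lemma pd_cont {w : EuclideanSpace ℝ (Fin n) → ℝ} (hw : ContDiff ℝ 2 w) (i : Fin n) : ContDiff ℝ 1 (pd w i) :=
  (hw.fderiv_right (m := 1) (by norm_num)).clm_apply contDiff_const

lemma lap_cont {w : EuclideanSpace ℝ (Fin n) → ℝ} (hw : ContDiff ℝ 2 w) : Continuous (lap w) :=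
  continuous_finsetSum _ fun _ _ => czH_cont hw _ _

lemma lap_supp {w : EuclideanSpace ℝ (Fin n) → ℝ} (hw : ContDiff ℝ 2 w) (hc : HasCompactSupport w) :
    lap w ∈ czCC (EuclideanSpace ℝ (Fin n)) := by
  have : lap w = ∑ i, pd2 w i i := by ext x; simp [lap]
  rw [this]
  exact Submodule.sum_mem _ fun i _ => czH_mem hw hc _ _

lemma pd_mul {χ w : EuclideanSpace ℝ (Fin n) → ℝ} {x} (hχ : DifferentiableAt ℝ χ x) (hw : DifferentiableAt ℝ w x) (i : Fin n) :
    pd (fun y => χ y * w y) i x = χ x * pd w i x + w x * pd χ i x := by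
  rw [pd, fderiv_fun_mul hχ hw]; rfl

lemma lap_mul {χ w : EuclideanSpace ℝ (Fin n) → ℝ} (hχ : ContDiff ℝ 2 χ) (hw : ContDiff ℝ 2 w) (x) :
    lap (fun y => χ y * w y) x = χ x * lap w x + 2 * (∑ i, pd χ i x * pd w i x) + w x * lap χ x := by
  have dχ := hχ.differentiable (by norm_num)
  have dw := hw.differentiable (by norm_num)
  have dχ1 := fun i => (pd_cont hχ i).differentiable (by norm_num)
  have dw1 := fun i => (pd_cont hw i).differentiable (by norm_num)
  have h2 : ∀ i, pd2 (fun y => χ y * w y) i i x = χ x * pd2 w i i x + 2 * (pd χ i x * pd w i x) + w x * pd2 χ i i x := by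
    intro i
    have e : pd (fun y => χ y * w y) i = fun y => χ y * pd w i y + w y * pd χ i y := by
      ext y; exact pd_mul (dχ y) (dw y) i
    have e1 := pd_mul (dχ x) (dw1 i x) i
    have e2 := pd_mul (dw x) (dχ1 i x) i
    have e3 : pd (fun y => χ y * pd w i y + w y * pd χ i y) i x =
        pd (fun y => χ y * pd w i y) i x + pd (fun y => w y * pd χ i y) i x := by
      rw [pd, fderiv_fun_add ((dχ x).fun_mul (dw1 i x)) ((dw x).fun_mul (dχ1 i x))]; rfl
    rw [pd2, e, e3, e1, e2]
    simp only [pd2]; ring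
  simp only [lap, h2, Finset.sum_add_distrib, Finset.mul_sum]

lemma lap_mul_norm {χ w : EuclideanSpace ℝ (Fin n) → ℝ} (hχ : ContDiff ℝ 2 χ) (hw : ContDiff ℝ 2 w)
    {a b : ℝ}
    (h1 : ∀ i x, |pd χ i x| ≤ a) (h2 : ∀ i x, |pd2 χ i i x| ≤ b) {P : ENNReal} (hP : 1 ≤ P) :
    eLpNorm (lap (fun y => χ y * w y)) P volume ≤ eLpNorm (fun x => χ x * lap w x) P volume +
      ENNReal.ofReal (2 * a) * (∑ i, eLpNorm (pd w i) P volume) + ENNReal.ofReal (n * b) * eLpNorm w P volume := by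
  have e : lap (fun y => χ y * w y) = ((fun x => χ x * lap w x) + (∑ i, fun x => 2 * pd χ i x * pd w i x))
      + (fun x => lap χ x * w x) := by
    ext x; simp only [lap_mul hχ hw, Pi.add_apply, Finset.sum_apply, Finset.mul_sum]
    congr 1
    · congr 1; refine Finset.sum_congr rfl fun i _ => by ring
    · ring
  have cχ := hχ.continuous
  have cw := hw.continuous
  have cl := lap_cont hw
  have clχ := lap_cont hχ
  have cp := fun i => (pd_cont hw i).continuous
  have cpχ := fun i => (pd_cont hχ i).continuous
  have m1 : AEStronglyMeasurable (fun x => χ x * lap w x) volume := (cχ.mul cl).aestronglyMeasurable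
  have m2 : ∀ i, AEStronglyMeasurable (fun x => 2 * pd χ i x * pd w i x) volume := fun i =>
    ((continuous_const.mul (cpχ i)).mul (cp i)).aestronglyMeasurable
  have m3 : AEStronglyMeasurable (fun x => lap χ x * w x) volume := (clχ.mul cw).aestronglyMeasurable
  have m4 : AEStronglyMeasurable (∑ i, fun x => 2 * pd χ i x * pd w i x) volume :=
    Finset.aestronglyMeasurable_sum _ fun i _ => m2 i
  rw [e]
  refine (eLpNorm_add_le (m1.add m4) m3 hP).trans (add_le_add ((eLpNorm_add_le m1 m4 hP).trans (add_le_add le_rfl ?_)) ?_)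
  · refine (eLpNorm_sum_le (fun i _ => m2 i) hP).trans ?_
    rw [Finset.mul_sum]
    refine Finset.sum_le_sum fun i _ => ?_
    refine eLpNorm_le_mul_eLpNorm_of_ae_le_mul (Filter.Eventually.of_forall fun x => ?_) P
    rw [Real.norm_eq_abs, abs_mul, abs_mul, Real.norm_eq_abs, abs_two]
    have := h1 i x
    gcongr
  · refine eLpNorm_le_mul_eLpNorm_of_ae_le_mul (Filter.Eventually.of_forall fun x => ?_) P
    rw [Real.norm_eq_abs, abs_mul, Real.norm_eq_abs]
    have : |lap χ x| ≤ n * b := by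
      refine (Finset.abs_sum_le_sum_abs _ _).trans ((Finset.sum_le_sum fun i _ => h2 i x).trans ?_)
      simp
    gcongr
end loc1

section loc2
variable {n : ℕ}

lemma czX_zero {lam rho : ℝ} (hl : 0 ≤ lam) {x : EuclideanSpace ℝ (Fin n)} (hx : rho ≤ ‖x‖ ^ 2) :
    czX n lam rho x = 0 :=
  Real.smoothTransition.zero_of_nonpos (mul_nonpos_of_nonneg_of_nonpos hl (by linarith))

lemma czX_one {lam rho : ℝ} {x : EuclideanSpace ℝ (Fin n)} (hx : 1 ≤ lam * (rho - ‖x‖ ^ 2)) :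
    czX n lam rho x = 1 :=
  Real.smoothTransition.one_of_one_le hx

lemma czX_abs (lam rho : ℝ) (x : EuclideanSpace ℝ (Fin n)) : |czX n lam rho x| ≤ 1 :=
  abs_le.2 ⟨by linarith [Real.smoothTransition.nonneg (lam * (rho - ‖x‖ ^ 2)), show czX n lam rho x =
    Real.smoothTransition (lam * (rho - ‖x‖ ^ 2)) from rfl], Real.smoothTransition.le_one _⟩

lemma czXu {u : EuclideanSpace ℝ (Fin n) → ℝ}
    (hu : ContDiffOn ℝ (⊤ : ℕ∞) u (Metric.ball (0 : EuclideanSpace ℝ (Fin n)) 2)) {lam rho : ℝ} (hl : 0 ≤ lam)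
    (hr : rho ≤ 3) : ContDiff ℝ 2 (fun x => czX n lam rho x * u x) ∧ HasCompactSupport (fun x => czX n lam rho x * u x) := by
  constructor
  · rw [contDiff_iff_contDiffAt]
    intro x
    by_cases hx : ‖x‖ < 2
    · have h1 : ContDiffAt ℝ (⊤ : ℕ∞) u x := hu.contDiffAt (Metric.isOpen_ball.mem_nhds (by simpa using hx))
      exact ((czX_contDiff lam rho 2).contDiffAt).mul (h1.of_le (by exact_mod_cast le_top))
    · have hx2 : 3 < ‖x‖ ^ 2 := by push Not at hx; nlinarith
      have : (fun x => czX n lam rho x * u x) =ᶠ[nhds x] fun _ => 0 := by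
        have ho : ∀ᶠ y in nhds x, 3 < ‖y‖ ^ 2 :=
          (continuous_norm.pow 2).continuousAt.eventually (lt_mem_nhds hx2)
        filter_upwards [ho] with y hy
        rw [czX_zero hl (by linarith), zero_mul]
      exact contDiffAt_const.congr_of_eventuallyEq this
  · refine HasCompactSupport.intro (isCompact_closedBall (0 : EuclideanSpace ℝ (Fin n)) 2) fun x hx => ?_
    have hx1 : 2 < ‖x‖ := by simpa using hx
    rw [czX_zero hl (by nlinarith), zero_mul]

lemma pd2_congr {f g : EuclideanSpace ℝ (Fin n) → ℝ} {x} (h : f =ᶠ[nhds x] g) (i j : Fin n) :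
    pd2 f i j x = pd2 g i j x := by
  have h1 : pd f j =ᶠ[nhds x] pd g j := by
    filter_upwards [h.fderiv (𝕜 := ℝ)] with y hy
    simp only [pd, hy]
  simp only [pd2]
  rw [pd, pd, h1.fderiv_eq]

lemma lap_congr {f g : EuclideanSpace ℝ (Fin n) → ℝ} {x} (h : f =ᶠ[nhds x] g) : lap f x = lap g x := by
  simp only [lap, pd2_congr h]

/-- radii -/
noncomputable def czr (k : ℕ) : ℝ := 2 - (1 / 2) ^ k

/-- localized functions -/
noncomputable def czV (u : EuclideanSpace ℝ (Fin n) → ℝ) (k : ℕ) (x : EuclideanSpace ℝ (Fin n)) : ℝ :=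
  czX n (2 ^ (k + 1)) (czr (k + 1)) x * u x

lemma czr_lt (k : ℕ) : czr k < 2 := by
  have : (0:ℝ) < (1 / 2) ^ k := by positivity
  rw [czr]; linarith

lemma czX_one_r (k : ℕ) {x : EuclideanSpace ℝ (Fin n)} (hx : ‖x‖ ^ 2 ≤ czr k) :
    czX n (2 ^ (k + 1)) (czr (k + 1)) x = 1 := by
  apply czX_one
  have h1 : czr (k + 1) - czr k = (1 / 2) ^ (k + 1) := by simp only [czr]; ring
  have h2 : (2:ℝ) ^ (k + 1) * (1 / 2) ^ (k + 1) = 1 := by rw [← mul_pow]; norm_num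
  have h3 : (0:ℝ) < 2 ^ (k + 1) := by positivity
  nlinarith

lemma czV_rec (u : EuclideanSpace ℝ (Fin n) → ℝ) (k : ℕ) :
    czV u k = fun x => czX n (2 ^ (k + 1)) (czr (k + 1)) x * czV u (k + 1) x := by
  ext x
  by_cases hx : ‖x‖ ^ 2 ≤ czr (k + 1)
  · rw [czV, czV, czX_one_r (k + 1) hx, one_mul]
  · rw [czV, czX_zero (by positivity) (by linarith), zero_mul, zero_mul]

lemma czV_eq (u : EuclideanSpace ℝ (Fin n) → ℝ) (k : ℕ) {x : EuclideanSpace ℝ (Fin n)} (hx : ‖x‖ ^ 2 < czr k) :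
    czV u k =ᶠ[nhds x] u := by
  have ho : ∀ᶠ y in nhds x, ‖y‖ ^ 2 < czr k :=
    (continuous_norm.pow 2).continuousAt.eventually (gt_mem_nhds hx)
  filter_upwards [ho] with y hy
  rw [czV, czX_one_r k hy.le, one_mul]

lemma czV_W (u : EuclideanSpace ℝ (Fin n) → ℝ) (k : ℕ) :
    czV u k = fun x => czX n (2 ^ (k + 1)) (czr (k + 1)) x * (czX n 1 3 x * u x) := by
  ext x
  by_cases hx : ‖x‖ ^ 2 ≤ 2
  · rw [czX_one (rho := 3) (by linarith), one_mul, czV]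
  · rw [czV, czX_zero (by positivity) (by linarith [czr_lt (k + 1)]), zero_mul, zero_mul]

lemma cz_ind {P : ENNReal} {f g : EuclideanSpace ℝ (Fin n) → ℝ}
    (h : ∀ x, ‖x‖ ^ 2 < 2 → |f x| ≤ |g x|) (h0 : ∀ x, 2 ≤ ‖x‖ ^ 2 → f x = 0) :
    eLpNorm f P volume ≤ eLpNorm g P (volume.restrict (Metric.ball (0 : EuclideanSpace ℝ (Fin n)) 2)) := by
  rw [← eLpNorm_indicator_eq_eLpNorm_restrict measurableSet_ball]
  refine eLpNorm_mono fun x => ?_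
  by_cases hx : ‖x‖ ^ 2 < 2
  · rw [Set.indicator_of_mem]
    · exact h x hx
    · have : ‖x‖ < 2 := by nlinarith [norm_nonneg x]
      simpa using this
  · rw [h0 x (by linarith)]; simp

end loc2

/-- Local interior Calderón–Zygmund estimate on Euclidean balls: for `n ≥ 1` and
`1 < p < ∞` there is `C = C(n,p) > 0` such that every `u` smooth on `B₂(0)` satisfies
`‖Hess u‖_{L^p(B₁)} ≤ C (‖u‖_{L^p(B₂)} + ‖Δu‖_{L^p(B₂)})`. -/
theorem local_calderon_zygmund (n : ℕ) (hn : 1 ≤ n) (p : ℝ) (hp : 1 < p) :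
    ∃ C : ℝ, 0 < C ∧ ∀ u : EuclideanSpace ℝ (Fin n) → ℝ,
      ContDiffOn ℝ (⊤ : ℕ∞) u (Metric.ball (0 : EuclideanSpace ℝ (Fin n)) 2) →
      eLpNorm (hessNorm u) (ENNReal.ofReal p)
          (volume.restrict (Metric.ball (0 : EuclideanSpace ℝ (Fin n)) 1)) ≤
        ENNReal.ofReal C *
          (eLpNorm u (ENNReal.ofReal p)
              (volume.restrict (Metric.ball (0 : EuclideanSpace ℝ (Fin n)) 2)) +
            eLpNorm (lap u) (ENNReal.ofReal p)
              (volume.restrict (Metric.ball (0 : EuclideanSpace ℝ (Fin n)) 2))) := by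
  obtain ⟨C, hC, hglob⟩ := cz_global n p hp
  obtain ⟨M, hM, hX⟩ := czX_bound
  have hP : 1 ≤ ENNReal.ofReal p := by rw [← ENNReal.ofReal_one]; exact ENNReal.ofReal_le_ofReal hp.le
  have hn0 : (0:ℝ) < n := by exact_mod_cast hn
  set P := ENNReal.ofReal p with hPd
  set A : ℝ := 64 * n ^ 2 * M ^ 2 * C + n * M with hA
  have hA0 : 0 < A := by positivity
  refine ⟨n ^ 2 * C * (2 + 8 * A), by positivity, ?_⟩
  intro u hu
  set NU := eLpNorm u P (volume.restrict (Metric.ball (0 : EuclideanSpace ℝ (Fin n)) 2)) with hNU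
  set ND := eLpNorm (lap u) P (volume.restrict (Metric.ball (0 : EuclideanSpace ℝ (Fin n)) 2)) with hND
  by_cases hfin : NU + ND = ⊤
  · rw [hfin, ENNReal.mul_top (by simp only [ne_eq, ENNReal.ofReal_eq_zero, not_le]; positivity)]; exact le_top
  obtain ⟨hUt, hDt⟩ : NU ≠ ⊤ ∧ ND ≠ ⊤ := by
    constructor <;> intro h <;> apply hfin <;> simp [h]
  have hlam : ∀ k : ℕ, (1:ℝ) ≤ 2 ^ (k + 1) := fun k => one_le_pow₀ (by norm_num)
  have hrk : ∀ k, czr k ≤ 3 := fun k => by linarith [czr_lt k]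
  have hV : ∀ k, ContDiff ℝ 2 (czV u k) ∧ HasCompactSupport (czV u k) := fun k =>
    czXu hu (by positivity) (hrk (k + 1))
  have hVU : ∀ k, eLpNorm (czV u k) P volume ≤ NU := fun k => by
    refine cz_ind (fun x hx => ?_) (fun x hx => ?_)
    · rw [czV, abs_mul]; exact mul_le_of_le_one_left (abs_nonneg _) (czX_abs _ _ _)
    · rw [czV, czX_zero (by positivity) (by linarith [czr_lt (k + 1)]), zero_mul]
  have hfinite : ∀ {f : EuclideanSpace ℝ (Fin n) → ℝ}, f ∈ czCC (EuclideanSpace ℝ (Fin n)) →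
      eLpNorm f P volume ≠ ⊤ := fun {f} hf => (czCC_memLp volume hf P).2.ne
  set l : ℕ → ℝ := fun k => (eLpNorm (lap (czV u k)) P volume).toReal with hl
  have hlof : ∀ k, eLpNorm (lap (czV u k)) P volume = ENNReal.ofReal (l k) := fun k =>
    (ENNReal.ofReal_toReal (hfinite (lap_supp (hV k).1 (hV k).2))).symm
  have hl0 : ∀ k, 0 ≤ l k := fun k => ENNReal.toReal_nonneg
  set D := ND.toReal with hDd
  set U := NU.toReal with hUd
  have hD : ND = ENNReal.ofReal D := (ENNReal.ofReal_toReal hDt).symm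
  have hU : NU = ENNReal.ofReal U := (ENNReal.ofReal_toReal hUt).symm
  have hD0 : 0 ≤ D := ENNReal.toReal_nonneg
  have hU0 : 0 ≤ U := ENNReal.toReal_nonneg
  -- recursion
  have hrec : ∀ k, l k ≤ 1 / 8 * l (k + 1) + D + 4 ^ k * (4 * A * U) := by
    intro k
    have hlk := hlam k
    set lam : ℝ := 2 ^ (k + 1) with hlamd
    have hlam0 : 0 < lam := by linarith
    have b := lap_mul_norm (czX_contDiff (n := n) lam (czr (k + 1)) 2) (hV (k + 1)).1
      (fun i x => (hX n lam (czr (k + 1)) hlk (hrk _) i x).1)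
      (fun i x => (hX n lam (czr (k + 1)) hlk (hrk _) i x).2) hP
    rw [← czV_rec u k, hlof] at b
    have b1 : eLpNorm (fun x => czX n lam (czr (k + 1)) x * lap (czV u (k + 1)) x) P volume ≤ ND := by
      refine cz_ind (fun x hx => ?_) (fun x hx => ?_)
      · by_cases h : ‖x‖ ^ 2 < czr (k + 1)
        · rw [lap_congr (czV_eq u (k + 1) h), abs_mul]
          exact mul_le_of_le_one_left (abs_nonneg _) (czX_abs _ _ _)
        · rw [czX_zero hlam0.le (by linarith), zero_mul, abs_zero]; exact abs_nonneg _
      · rw [czX_zero hlam0.le (by linarith [czr_lt (k + 1)]), zero_mul]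
    set ε : ℝ := 1 / (16 * n * M * C * lam) with hε
    have hε0 : 0 < ε := by positivity
    have b2 : ∀ i, eLpNorm (pd (czV u (k + 1)) i) P volume ≤ ENNReal.ofReal (2 * ε⁻¹ * U + ε * (C * l (k + 1))) := by
      intro i
      refine (cz_interp volume (hV (k + 1)).1 (hV (k + 1)).2 (EuclideanSpace.single i 1) hε0 p hp).trans ?_
      rw [ENNReal.ofReal_add (by positivity) (mul_nonneg hε0.le (mul_nonneg hC.le (hl0 _))),
        ENNReal.ofReal_mul (p := 2 * ε⁻¹) (by positivity), ENNReal.ofReal_mul hε0.le, ENNReal.ofReal_mul hC.le]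
      refine add_le_add (mul_le_mul_right ((hVU _).trans hU.le) _) (mul_le_mul_right ?_ _)
      have := hglob (czV u (k + 1)) (hV (k + 1)).1 (hV (k + 1)).2 i i
      rw [hlof] at this
      exact this
    have b3 : (∑ i, eLpNorm (pd (czV u (k + 1)) i) P volume) ≤
        ENNReal.ofReal (n * (2 * ε⁻¹ * U + ε * (C * l (k + 1)))) := by
      refine (Finset.sum_le_sum fun i _ => b2 i).trans ?_
      rw [ENNReal.ofReal_mul hn0.le]
      simp
    have nn : 0 ≤ 2 * ε⁻¹ * U + ε * (C * l (k + 1)) := by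
      have := hl0 (k + 1)
      positivity
    have b4 : ENNReal.ofReal (l k) ≤ ENNReal.ofReal (D + 2 * (M * lam) * (n * (2 * ε⁻¹ * U + ε * (C * l (k + 1)))) +
        n * (M * lam ^ 2) * U) := by
      refine b.trans ?_
      rw [ENNReal.ofReal_add (by positivity) (by positivity), ENNReal.ofReal_add (by positivity) (by positivity),
        ENNReal.ofReal_mul (p := 2 * (M * lam)) (by positivity), ENNReal.ofReal_mul (p := n * (M * lam ^ 2)) (by positivity)]
      exact add_le_add (add_le_add (b1.trans hD.le) (mul_le_mul_right b3 _)) (mul_le_mul_right ((hVU _).trans hU.le) _)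
    have b5 := (ENNReal.ofReal_le_ofReal_iff (by positivity)).1 b4
    refine b5.trans (le_of_eq ?_)
    have e4 : lam ^ 2 = 4 * 4 ^ k := by
      rw [hlamd, ← pow_mul, show (4:ℝ) = 2 ^ 2 by norm_num, ← pow_mul]; ring
    have e5 : (4:ℝ) ^ k = lam ^ 2 / 4 := by rw [e4]; ring
    rw [e5, hε, hA]
    field_simp
    ring
  -- growth
  obtain ⟨hW, hWc⟩ := czXu hu (lam := 1) (rho := 3) (by norm_num) le_rfl
  set W : EuclideanSpace ℝ (Fin n) → ℝ := fun x => czX n 1 3 x * u x with hWd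
  have hgr : ∃ G : ℝ, ∀ k, l k ≤ G * 4 ^ k := by
    have f1 : eLpNorm (lap W) P volume ≠ ⊤ := hfinite (lap_supp hW hWc)
    have f2 : (∑ i, eLpNorm (pd W i) P volume) ≠ ⊤ := by
      refine ENNReal.sum_ne_top.2 fun i _ => hfinite ⟨(pd_cont hW i).continuous, ?_⟩
      exact hWc.fderiv_apply ℝ (EuclideanSpace.single i 1)
    have f3 : eLpNorm W P volume ≠ ⊤ := hfinite ⟨hW.continuous, hWc⟩
    set g1 := (eLpNorm (lap W) P volume).toReal with hg1
    set g2 := (∑ i, eLpNorm (pd W i) P volume).toReal with hg2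
    set g3 := (eLpNorm W P volume).toReal with hg3
    have p1 : 0 ≤ g1 := ENNReal.toReal_nonneg
    have p2 : 0 ≤ g2 := ENNReal.toReal_nonneg
    have p3 : 0 ≤ g3 := ENNReal.toReal_nonneg
    refine ⟨g1 + 4 * M * g2 + 4 * n * M * g3, fun k => ?_⟩
    have hlk := hlam k
    set lam : ℝ := 2 ^ (k + 1) with hlamd
    have hlam0 : 0 < lam := by linarith
    have b := lap_mul_norm (czX_contDiff (n := n) lam (czr (k + 1)) 2) hW
      (fun i x => (hX n lam (czr (k + 1)) hlk (hrk _) i x).1)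
      (fun i x => (hX n lam (czr (k + 1)) hlk (hrk _) i x).2) hP
    rw [← czV_W u k, hlof] at b
    have b1 : eLpNorm (fun x => czX n lam (czr (k + 1)) x * lap W x) P volume ≤ eLpNorm (lap W) P volume := by
      refine eLpNorm_mono fun x => ?_
      rw [norm_mul]
      exact mul_le_of_le_one_left (norm_nonneg _) (czX_abs _ _ _)
    have b4 : ENNReal.ofReal (l k) ≤ ENNReal.ofReal (g1 + 2 * (M * lam) * g2 + n * (M * lam ^ 2) * g3) := by
      refine b.trans ?_
      rw [ENNReal.ofReal_add (by positivity) (by positivity), ENNReal.ofReal_add (by positivity) (by positivity),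
        ENNReal.ofReal_mul (p := 2 * (M * lam)) (by positivity), ENNReal.ofReal_mul (p := n * (M * lam ^ 2)) (by positivity),
        hg1, hg2, hg3, ENNReal.ofReal_toReal f1, ENNReal.ofReal_toReal f2, ENNReal.ofReal_toReal f3]
      exact add_le_add (add_le_add b1 le_rfl) le_rfl
    have b5 := (ENNReal.ofReal_le_ofReal_iff (by positivity)).1 b4
    refine b5.trans ?_
    have e4 : lam ^ 2 = 4 * 4 ^ k := by
      rw [hlamd, ← pow_mul, show (4:ℝ) = 2 ^ 2 by norm_num, ← pow_mul]; ring
    have e6 : (1:ℝ) ≤ 4 ^ k := one_le_pow₀ (by norm_num)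
    have e7 : lam ≤ 2 * 4 ^ k := by
      rw [hlamd, pow_succ, mul_comm]
      have : (2:ℝ) ^ k ≤ 4 ^ k := pow_le_pow_left₀ (by norm_num) (by norm_num) k
      linarith
    rw [e4]
    have t1 : g1 ≤ g1 * 4 ^ k := le_mul_of_one_le_right p1 e6
    have t2 : 2 * (M * lam) * g2 ≤ 2 * (M * (2 * 4 ^ k)) * g2 := by gcongr
    nlinarith
  obtain ⟨G, hG⟩ := hgr
  have hfinal := cz_iter l D (4 * A * U) G hD0 hrec hG (by positivity)
  -- conclusion
  have c1 : eLpNorm (hessNorm u) P (volume.restrict (Metric.ball (0 : EuclideanSpace ℝ (Fin n)) 1)) ≤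
      eLpNorm (∑ i, ∑ j, fun x => ‖pd2 (czV u 0) i j x‖) P (volume.restrict (Metric.ball (0 : EuclideanSpace ℝ (Fin n)) 1)) := by
    refine eLpNorm_mono_ae_real ?_
    filter_upwards [ae_restrict_mem measurableSet_ball] with x hx
    have hx1 : ‖x‖ < 1 := by simpa using hx
    have hx2 : ‖x‖ ^ 2 < czr 0 := by
      simp only [czr, pow_zero]; nlinarith [norm_nonneg x]
    have he : ∀ i j, pd2 u i j x = pd2 (czV u 0) i j x := fun i j => (pd2_congr (czV_eq u 0 hx2) i j).symm
    simp only [Finset.sum_apply, hessNorm, Real.norm_eq_abs, he]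
    rw [abs_of_nonneg (Real.sqrt_nonneg _)]
    apply Real.sqrt_le_iff.2
    refine ⟨by positivity, ?_⟩
    rw [← Fintype.sum_prod_type' (fun i j => pd2 (czV u 0) i j x ^ 2),
      ← Fintype.sum_prod_type' (fun i j => |pd2 (czV u 0) i j x|)]
    have := Finset.sum_sq_le_sq_sum_of_nonneg (s := Finset.univ)
      (f := fun z : Fin n × Fin n => |pd2 (czV u 0) z.1 z.2 x|) (fun z _ => abs_nonneg _)
    simpa using this
  have m1 : ∀ i j, AEStronglyMeasurable (fun x => ‖pd2 (czV u 0) i j x‖) volume := fun i j =>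
    (czH_cont (hV 0).1 _ _).norm.aestronglyMeasurable
  have c2 : eLpNorm (∑ i, ∑ j, fun x => ‖pd2 (czV u 0) i j x‖) P volume ≤
      ENNReal.ofReal (n ^ 2 * C * l 0) := by
    refine (eLpNorm_sum_le (fun i _ => Finset.aestronglyMeasurable_sum _ fun j _ => m1 i j) hP).trans ?_
    have : ∀ i, eLpNorm (∑ j, fun x => ‖pd2 (czV u 0) i j x‖) P volume ≤ n * ENNReal.ofReal (C * l 0) := by
      intro i
      refine (eLpNorm_sum_le (fun j _ => m1 i j) hP).trans ?_
      refine (Finset.sum_le_sum (g := fun _ => ENNReal.ofReal (C * l 0)) fun j _ => ?_).trans (by simp)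
      rw [eLpNorm_norm, ENNReal.ofReal_mul hC.le, ← hlof]
      exact hglob _ (hV 0).1 (hV 0).2 i j
    refine (Finset.sum_le_sum fun i _ => this i).trans (le_of_eq ?_)
    rw [show (n:ℝ) ^ 2 * C * l 0 = n * (n * (C * l 0)) by ring, ENNReal.ofReal_mul hn0.le, ENNReal.ofReal_mul hn0.le]
    simp
  refine c1.trans ((eLpNorm_mono_measure _ Measure.restrict_le_self).trans (c2.trans ?_))
  rw [hU, hD, ← ENNReal.ofReal_add hU0 hD0, ← ENNReal.ofReal_mul (by positivity)]
  apply ENNReal.ofReal_le_ofReal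
  rw [mul_assoc ((n:ℝ) ^ 2 * C)]
  refine mul_le_mul_of_nonneg_left ?_ (by positivity)
  nlinarith [mul_nonneg hA0.le hD0]
end

section
/- Local L^∞ gradient estimate: for every n ≥ 1 there exists a constant C = C(n) > 0 such that for all 0 < r ≤ 1, all x₀ ∈ ℝⁿ, and all smooth functions u on the open ball B_r(x₀) ⊂ ℝⁿ, one has sup_{B_{r/2}(x₀)} |∇u| ≤ C ( r^{−2} sup_{B_r(x₀)} |u| + sup_{B_r(x₀)} |Δu| ). -/
open MeasureTheory

open Filter Topology

lemma lm_second {g g' : ℝ → ℝ} {c : ℝ} (hg : ∀ᶠ t in 𝓝 (0:ℝ), HasDerivAt g (g' t) t)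
    (hg' : HasDerivAt g' c 0) (hm : IsLocalMin g 0) : 0 ≤ c := by
  by_contra! hc
  have hd : deriv g =ᶠ[𝓝 0] g' := hg.mono fun t ht => ht.deriv
  have h0 : deriv g 0 = 0 := hm.deriv_eq_zero
  have hdd : deriv (deriv g) 0 = c := by rw [hd.deriv_eq, hg'.deriv]
  have hM : IsLocalMax g 0 := isLocalMax_of_deriv_deriv_neg (by rw [hdd]; exact hc) h0
    hg.self_of_nhds.continuousAt
  have he : g =ᶠ[𝓝 0] fun _ => g 0 := by
    filter_upwards [hm, hM] with t h1 h2 using le_antisymm h2 h1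
  have h1 : deriv g =ᶠ[𝓝 0] fun _ => 0 := by
    have := he.deriv
    simpa using this
  have : deriv (deriv g) 0 = 0 := by rw [h1.deriv_eq]; simp
  linarith

lemma line_deriv {n : ℕ} {u : EuclideanSpace ℝ (Fin n) → ℝ} {i : Fin n} (s : ℝ)
    (z : EuclideanSpace ℝ (Fin n)) (t : ℝ)
    (h : DifferentiableAt ℝ u (z + (s * t) • EuclideanSpace.single i 1)) :
    HasDerivAt (fun t : ℝ => u (z + (s * t) • EuclideanSpace.single i (1:ℝ)))
      (s * pd u i (z + (s * t) • EuclideanSpace.single i 1)) t := by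
  have h1 : HasDerivAt (fun t : ℝ => z + (s * t) • EuclideanSpace.single i (1:ℝ))
      (s • EuclideanSpace.single i (1:ℝ)) t := by
    have h2 : HasDerivAt (fun t : ℝ => s * t) s t := by
      simpa using (hasDerivAt_id t).const_mul s
    exact (h2.smul_const _).const_add z
  have := h.hasFDerivAt.comp_hasDerivAt t h1
  simpa [pd, Function.comp_def] using this

lemma pd_diff {n : ℕ} {u : EuclideanSpace ℝ (Fin n) → ℝ} {i : Fin n}
    {z : EuclideanSpace ℝ (Fin n)} (h : ContDiffAt ℝ 2 u z) : DifferentiableAt ℝ (pd u i) z := by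
  have h1 : ContDiffAt ℝ 1 (fderiv ℝ u) z := h.fderiv_right (by norm_num)
  exact (h1.differentiableAt (by norm_num)).clm_apply (differentiableAt_const _)

/-- reflection -/
noncomputable def refl' {n : ℕ} (x : EuclideanSpace ℝ (Fin n)) (k : Fin n)
    (y : EuclideanSpace ℝ (Fin n)) : EuclideanSpace ℝ (Fin n) :=
  y - (2 * (y k - x k)) • EuclideanSpace.single k (1:ℝ)

lemma refl_line {n : ℕ} (x y : EuclideanSpace ℝ (Fin n)) (k i : Fin n) (t : ℝ) :
    refl' x k (y + t • EuclideanSpace.single i (1:ℝ)) =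
      refl' x k y + ((if i = k then (-1:ℝ) else 1) * t) • EuclideanSpace.single i (1:ℝ) := by
  ext j
  by_cases hik : i = k
  · subst hik
    by_cases hj : j = i
    · subst hj; simp [refl']; ring
    · simp [refl', hj]
  · have hki : k ≠ i := fun h => hik h.symm
    simp [refl', hik, hki]; ring

lemma norm_line {n : ℕ} (q : EuclideanSpace ℝ (Fin n)) (i : Fin n) (t : ℝ) :
    ‖q + t • EuclideanSpace.single i (1:ℝ)‖ ^ 2 = ‖q‖ ^ 2 + 2 * t * q i + t ^ 2 := by
  rw [norm_add_sq_real, inner_smul_right, norm_smul]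
  simp [EuclideanSpace.inner_single_right]
  ring

lemma half_cube {n : ℕ} {x : EuclideanSpace ℝ (Fin n)} {S : Set (EuclideanSpace ℝ (Fin n))}
    (hS : IsOpen S) {u : EuclideanSpace ℝ (Fin n) → ℝ} (hu : ContDiffOn ℝ 2 u S)
    {d M N N' σ : ℝ} (hd : 0 < d) (hN : N < N') (hσ : |σ| ≤ 1)
    (hcube : ∀ z : EuclideanSpace ℝ (Fin n), (∀ i, |z i - x i| ≤ d) → z ∈ S)
    (hM : ∀ z ∈ S, |u z| ≤ M) (hL : ∀ z ∈ S, |lap u z| ≤ N) (k : Fin n)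
    (y : EuclideanSpace ℝ (Fin n)) (hy : ∀ i, |y i - x i| ≤ d) (hyk : 0 ≤ y k - x k) :
    σ / 2 * (u y - u (refl' x k y)) ≤
      M / d ^ 2 * ‖y - x‖ ^ 2 + (n * M / d ^ 2 + N' / 2) * ((y k - x k) * (d - (y k - x k))) := by
  set A := M / d ^ 2 with hA
  set B := n * M / d ^ 2 + N' / 2 with hB
  have hxS : x ∈ S := hcube x (by simp [hd.le])
  have hM0 : 0 ≤ M := (abs_nonneg _).trans (hM x hxS)
  have hN0 : 0 ≤ N := (abs_nonneg _).trans (hL x hxS)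
  have hA0 : 0 ≤ A := by positivity
  have hB0 : 0 ≤ B := by have : 0 ≤ N' := by linarith
                         positivity
  have hcd : ∀ z ∈ S, ContDiffAt ℝ 2 u z := fun z hz => hu.contDiffAt (hS.mem_nhds hz)
  have hrefl : ∀ z : EuclideanSpace ℝ (Fin n), (∀ i, |z i - x i| ≤ d) → refl' x k z ∈ S := by
    intro z hz
    apply hcube
    intro i
    by_cases hi : i = k
    · subst hi
      have : (refl' x i z) i - x i = -(z i - x i) := by simp [refl']; ring
      rw [this, abs_neg]; exact hz i
    · have : (refl' x k z) i = z i := by simp [refl', hi]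
      rw [this]; exact hz i
  let K : Set (EuclideanSpace ℝ (Fin n)) := {z | (∀ i, |z i - x i| ≤ d) ∧ 0 ≤ z k - x k}
  let U : Set (EuclideanSpace ℝ (Fin n)) := {z | (∀ i, |z i - x i| < d) ∧ 0 < z k - x k}
  let w : EuclideanSpace ℝ (Fin n) → ℝ := fun y =>
    A * ‖y - x‖ ^ 2 + B * ((y k - x k) * (d - (y k - x k))) - σ / 2 * (u y - u (refl' x k y))
  have hUK : U ⊆ K := fun z hz => ⟨fun i => (hz.1 i).le, hz.2.le⟩
  have hUo : IsOpen U := by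
    have h1 : IsOpen {z : EuclideanSpace ℝ (Fin n) | ∀ i, |z i - x i| < d} := by
      simp only [Set.ofPred_forall]
      exact isOpen_iInter_of_finite fun i => isOpen_lt (by fun_prop) (by fun_prop)
    have h2 : IsOpen {z : EuclideanSpace ℝ (Fin n) | 0 < z k - x k} :=
      isOpen_lt (by fun_prop) (by fun_prop)
    exact h1.inter h2
  have hKc : IsCompact K := by
    apply Metric.isCompact_of_isClosed_isBounded
    · have h1 : IsClosed {z : EuclideanSpace ℝ (Fin n) | ∀ i, |z i - x i| ≤ d} := by
        simp only [Set.ofPred_forall]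
        exact isClosed_iInter fun i => isClosed_le (by fun_prop) (by fun_prop)
      have h2 : IsClosed {z : EuclideanSpace ℝ (Fin n) | 0 ≤ z k - x k} :=
        isClosed_le (by fun_prop) (by fun_prop)
      exact h1.inter h2
    · apply (Metric.isBounded_closedBall (x := x) (r := Real.sqrt (n * d ^ 2))).subset
      intro z hz
      rw [Metric.mem_closedBall, dist_eq_norm, EuclideanSpace.norm_eq]
      apply Real.sqrt_le_sqrt
      calc ∑ i, ‖(z - x) i‖ ^ 2 ≤ ∑ i : Fin n, d ^ 2 := by
            apply Finset.sum_le_sum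
            intro i _
            have := hz.1 i
            simp only [PiLp.sub_apply, Real.norm_eq_abs]
            gcongr
        _ = n * d ^ 2 := by simp
  have hreflc : Continuous (refl' x k) := by unfold refl'; fun_prop
  have hwc : ContinuousOn w K := by
    have h1 : ContinuousOn u K := hu.continuousOn.mono fun z hz => hcube z hz.1
    have h2 : ContinuousOn (fun z => u (refl' x k z)) K :=
      hu.continuousOn.comp hreflc.continuousOn fun z hz => hrefl z hz.1
    have h3 : Continuous fun y : EuclideanSpace ℝ (Fin n) =>
      A * ‖y - x‖ ^ 2 + B * ((y k - x k) * (d - (y k - x k))) := by fun_prop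
    exact h3.continuousOn.sub ((h1.sub h2).const_smul (σ / 2))
  obtain ⟨z, hzK, hzmin⟩ := hKc.exists_isMinOn ⟨y, hy, hyk⟩ hwc
  have hzS := hcube z hzK.1
  have hzR := hrefl z hzK.1
  suffices h : 0 ≤ w z by
    have : w z ≤ w y := hzmin ⟨hy, hyk⟩
    have h2 := h.trans this
    simp only [w] at h2
    linarith
  by_contra! hneg
  have hkd : z k - x k ≤ d := (abs_le.1 (hzK.1 k)).2
  have hosc : σ / 2 * (u z - u (refl' x k z)) ≤ M := by
    have h1 := abs_le.1 (hM z hzS)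
    have h2 := abs_le.1 (hM _ hzR)
    calc _ ≤ |σ / 2 * (u z - u (refl' x k z))| := le_abs_self _
      _ = |σ| * (|u z - u (refl' x k z)| / 2) := by
          rw [abs_mul, abs_div]; norm_num; ring
      _ ≤ 1 * M := by
          apply mul_le_mul hσ _ (by positivity) zero_le_one
          have : |u z - u (refl' x k z)| ≤ 2 * M := abs_le.2 ⟨by linarith, by linarith⟩
          linarith
      _ = M := one_mul M
  have hBnn : 0 ≤ B * ((z k - x k) * (d - (z k - x k))) :=
    mul_nonneg hB0 (mul_nonneg hzK.2 (by linarith))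
  have hzU : z ∈ U := by
    constructor
    · intro i
      refine lt_of_le_of_ne (hzK.1 i) fun heq => ?_
      have h1 : d ^ 2 ≤ ‖z - x‖ ^ 2 := by
        have := PiLp.norm_apply_le (z - x) i
        rw [PiLp.sub_apply, Real.norm_eq_abs, heq] at this
        gcongr
      have h2 : M ≤ A * ‖z - x‖ ^ 2 := by
        calc M = A * d ^ 2 := by rw [hA]; field_simp
          _ ≤ _ := by gcongr
      simp only [w] at hneg
      linarith
    · refine lt_of_le_of_ne hzK.2 fun heq => ?_
      have h1 : refl' x k z = z := by simp [refl', ← heq]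
      simp only [w, h1] at hneg
      have : 0 ≤ A * ‖z - x‖ ^ 2 := by positivity
      simp only [sub_self, mul_zero] at hneg
      linarith
  -- second derivative in each direction
  have key : ∀ i : Fin n, 0 ≤ 2 * A - (if i = k then 2 * B else 0)
      - σ / 2 * (pd2 u i i z - pd2 u i i (refl' x k z)) := by
    intro i
    set s : ℝ := if i = k then (-1:ℝ) else 1 with hs
    set δ : ℝ := if i = k then (1:ℝ) else 0 with hδ
    set e := EuclideanSpace.single i (1:ℝ) with he
    have hss : s * s = 1 := by rw [hs]; split_ifs <;> norm_num
    have hδδ : δ * δ = δ := by rw [hδ]; split_ifs <;> norm_num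
    have hδ2 : (if i = k then 2 * B else 0) = 2 * B * δ := by rw [hδ]; split_ifs <;> ring
    have hek : e k = δ := by
      rw [he, hδ]; simp [Pi.single_apply, eq_comm]
    let g : ℝ → ℝ := fun t => (A * (‖z - x‖ ^ 2 + 2 * t * (z i - x i) + t ^ 2)
      + B * ((z k - x k + t * δ) * (d - (z k - x k + t * δ))))
      - σ / 2 * (u (z + (1 * t) • e) - u (refl' x k z + (s * t) • e))
    let g' : ℝ → ℝ := fun t => (A * (2 * (z i - x i) + 2 * t)
      + B * (δ * (d - (z k - x k + t * δ)) + (z k - x k + t * δ) * (-δ)))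
      - σ / 2 * (1 * pd u i (z + (1 * t) • e) - s * pd u i (refl' x k z + (s * t) • e))
    have hgw : ∀ t, g t = w (z + t • e) := by
      intro t
      have h1 : z + t • e - x = (z - x) + t • e := by abel
      simp only [g, w, h1]
      rw [refl_line, norm_line]
      simp only [one_mul, PiLp.sub_apply, PiLp.add_apply, PiLp.smul_apply, smul_eq_mul, hek]
      ring
    have hline : ∀ (s : ℝ) (v : EuclideanSpace ℝ (Fin n)), 
        Tendsto (fun t : ℝ => v + (s * t) • e) (𝓝 0) (𝓝 v) := by
      intro s v
      have : Continuous (fun t : ℝ => v + (s * t) • e) := by fun_prop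
      simpa using this.tendsto 0
    rw [hδ2]
    refine lm_second (g := g) (g' := g') ?_ ?_ ?_
    · filter_upwards [(hline 1 z).eventually (hS.mem_nhds hzS),
        (hline s (refl' x k z)).eventually (hS.mem_nhds hzR)] with t h1 h2
      have a1 := line_deriv (i := i) 1 z t ((hcd _ h1).differentiableAt (by norm_num))
      have a2 := line_deriv (i := i) s _ t ((hcd _ h2).differentiableAt (by norm_num))
      have b1 : HasDerivAt (fun t : ℝ => z k - x k + t * δ) δ t := by
        simpa using ((hasDerivAt_id t).mul_const δ).const_add (z k - x k)
      have b2 : HasDerivAt (fun t : ℝ => ‖z - x‖ ^ 2 + 2 * t * (z i - x i) + t ^ 2)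
          (2 * (z i - x i) + 2 * t) t := by
        have c1 := (((hasDerivAt_id t).const_mul 2).mul_const (z i - x i)).const_add (‖z - x‖ ^ 2)
        have c2 := c1.add (hasDerivAt_pow 2 t)
        refine (c2.congr_deriv ?_)
        simp
      exact ((b2.const_mul A).add ((b1.mul (b1.const_sub d)).const_mul B)).sub
        ((a1.sub a2).const_mul (σ / 2))
    · have a1 := line_deriv (u := pd u i) (i := i) 1 z 0 (by simpa using pd_diff (hcd _ hzS))
      have a2 := line_deriv (u := pd u i) (i := i) s (refl' x k z) 0
        (by simpa using pd_diff (hcd _ hzR))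
      have b1 : HasDerivAt (fun t : ℝ => z k - x k + t * δ) δ 0 := by
        simpa using ((hasDerivAt_id (0:ℝ)).mul_const δ).const_add (z k - x k)
      have b2 : HasDerivAt (fun t : ℝ => 2 * (z i - x i) + 2 * t) 2 0 := by
        simpa using ((hasDerivAt_id (0:ℝ)).const_mul 2).const_add (2 * (z i - x i))
      have := ((b2.const_mul A).add ((((b1.const_sub d).const_mul δ).add
        (b1.mul_const (-δ))).const_mul B)).sub
        (((a1.const_mul 1).sub (a2.const_mul s)).const_mul (σ / 2))
      refine this.congr_deriv ?_
      simp only [mul_zero, zero_smul, add_zero, one_mul, pd2]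
      linear_combination (-2 * B) * hδδ + (σ / 2 * pd (pd u i) i (refl' x k z)) * hss
    · have h1 := (hline 1 z).eventually (hUo.mem_nhds hzU)
      filter_upwards [h1] with t ht
      rw [hgw, hgw, zero_smul, add_zero]
      rw [one_mul] at ht
      exact hzmin (hUK ht)
  have hsum := Finset.sum_nonneg fun i (_ : i ∈ Finset.univ) => key i
  rw [Finset.sum_sub_distrib, Finset.sum_sub_distrib, ← Finset.mul_sum Finset.univ _ (σ / 2),
    Finset.sum_sub_distrib] at hsum
  simp only [Finset.sum_const, Finset.card_univ, Fintype.card_fin, nsmul_eq_mul,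
    Finset.sum_ite_eq', Finset.mem_univ, if_true] at hsum
  change 0 ≤ _ - σ / 2 * (lap u z - lap u (refl' x k z)) at hsum
  have hlap : -(σ / 2 * (lap u z - lap u (refl' x k z))) ≤ N := by
    have h1 := abs_le.1 (hL z hzS)
    have h2 := abs_le.1 (hL _ hzR)
    calc _ ≤ |σ / 2 * (lap u z - lap u (refl' x k z))| := neg_le_abs _
      _ = |σ| * (|lap u z - lap u (refl' x k z)| / 2) := by
          rw [abs_mul, abs_div]; norm_num; ring
      _ ≤ 1 * N := by
          apply mul_le_mul hσ _ (by positivity) zero_le_one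
          have : |lap u z - lap u (refl' x k z)| ≤ 2 * N := abs_le.2 ⟨by linarith, by linarith⟩
          linarith
      _ = N := one_mul N
  have hAB : n * (2 * A) - 2 * B = -N' := by rw [hA, hB]; ring
  linarith

lemma pd_bound {n : ℕ} {x : EuclideanSpace ℝ (Fin n)} {S : Set (EuclideanSpace ℝ (Fin n))}
    (hS : IsOpen S) {u : EuclideanSpace ℝ (Fin n) → ℝ} (hu : ContDiffOn ℝ 2 u S)
    {d M N : ℝ} (hd : 0 < d)
    (hcube : ∀ z : EuclideanSpace ℝ (Fin n), (∀ i, |z i - x i| ≤ d) → z ∈ S)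
    (hM : ∀ z ∈ S, |u z| ≤ M) (hL : ∀ z ∈ S, |lap u z| ≤ N) (k : Fin n) :
    |pd u k x| ≤ (n * M / d ^ 2 + N / 2) * d := by
  have hxS : x ∈ S := hcube x (by simp [hd.le])
  have hdu : DifferentiableAt ℝ u x :=
    (hu.contDiffAt (hS.mem_nhds hxS)).differentiableAt (by norm_num)
  have main : ∀ σ : ℝ, |σ| ≤ 1 → ∀ N' > N, σ * pd u k x ≤ (n * M / d ^ 2 + N' / 2) * d := by
    intro σ hσ N' hN'
    set B := n * M / d ^ 2 + N' / 2 with hB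
    set e := EuclideanSpace.single k (1:ℝ) with he
    have a1 := line_deriv (u := u) (i := k) 1 x 0 (by simpa using hdu)
    have a2 := line_deriv (u := u) (i := k) (-1) x 0 (by simpa using hdu)
    have a3 : HasDerivAt (fun t : ℝ => σ / 2 * (u (x + (1 * t) • e) - u (x + ((-1) * t) • e)))
        (σ * pd u k x) 0 := by
      refine ((a1.sub a2).const_mul (σ / 2)).congr_deriv ?_
      simp only [mul_zero, zero_smul, add_zero]
      ring
    have h1 := a3.tendsto_slope_zero_right
    have h2 : Tendsto (fun t : ℝ => M / d ^ 2 * t + B * (d - t)) (𝓝[>] 0) (𝓝 (B * d)) := by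
      have : Continuous (fun t : ℝ => M / d ^ 2 * t + B * (d - t)) := by fun_prop
      have h3 := this.tendsto 0
      simp only [mul_zero, zero_add, sub_zero] at h3
      exact h3.mono_left nhdsWithin_le_nhds
    refine le_of_tendsto_of_tendsto h1 h2 ?_
    filter_upwards [Ioc_mem_nhdsGT hd] with t ht
    have ht0 : 0 < t := ht.1
    have hr : refl' x k (x + t • e) = x + ((-1) * t) • e := by
      rw [refl_line]; simp [refl', he]
    have hc := half_cube hS hu hd hN' hσ hcube hM hL k (x + t • e) (by
      intro i
      by_cases hi : i = k
      · subst hi; simp [he, abs_of_pos ht0, ht.2]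
      · simp [he, hi, hd.le]) (by simp [he, ht0.le])
    rw [hr] at hc
    have hn1 : ‖x + t • e - x‖ ^ 2 = t ^ 2 := by simp [he, norm_smul]
    have hn2 : (x + t • e) k - x k = t := by simp [he]
    rw [hn1, hn2, ← hB] at hc
    simp only [zero_add, one_mul, mul_zero, zero_smul, add_zero, sub_self, sub_zero, smul_eq_mul]
    rw [inv_mul_le_iff₀ ht0]
    linarith
  have main2 : ∀ σ : ℝ, |σ| ≤ 1 → σ * pd u k x ≤ (n * M / d ^ 2 + N / 2) * d := by
    intro σ hσ
    apply le_of_forall_pos_le_add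
    intro ε hε
    have := main σ hσ (N + 2 * ε / d) (by have : 0 < 2 * ε / d := by positivity
                                          linarith)
    refine this.trans (le_of_eq ?_)
    field_simp
    ring
  have h1 := main2 1 (by simp)
  have h2 := main2 (-1) (by simp)
  exact abs_le.2 ⟨by linarith, by linarith⟩

/-- Zhang–Zhu local `L^∞` gradient estimate specialized to `ℝⁿ`: there is `C = C(n) > 0`
such that for `0 < r ≤ 1`, any `x₀`, and any `u` smooth on `B_r(x₀)`, the gradient on
`B_{r/2}(x₀)` is bounded by `C (r⁻² sup_{B_r} |u| + sup_{B_r} |Δu|)`. -/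
theorem local_Linfty_gradient_estimate (n : ℕ) (hn : 1 ≤ n) :
    ∃ C : ℝ, 0 < C ∧ ∀ r : ℝ, 0 < r → r ≤ 1 → ∀ x₀ : EuclideanSpace ℝ (Fin n),
      ∀ u : EuclideanSpace ℝ (Fin n) → ℝ, ContDiffOn ℝ (⊤ : ℕ∞) u (Metric.ball x₀ r) →
      ∀ Mu Mf : ℝ, (∀ x ∈ Metric.ball x₀ r, |u x| ≤ Mu) →
        (∀ x ∈ Metric.ball x₀ r, |lap u x| ≤ Mf) →
        ∀ x ∈ Metric.ball x₀ (r / 2), gradNorm u x ≤ C * ((r ^ 2)⁻¹ * Mu + Mf) := by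
  have hn1 : (1:ℝ) ≤ n := by exact_mod_cast hn
  have hn0 : (0:ℝ) < n := by linarith
  refine ⟨n * (2 * n ^ 2), by positivity, ?_⟩
  intro r hr hr1 x₀ u hu Mu Mf hMu hMf x hx
  have hx₀ : x₀ ∈ Metric.ball x₀ r := Metric.mem_ball_self hr
  have hMu0 : 0 ≤ Mu := (abs_nonneg _).trans (hMu x₀ hx₀)
  have hMf0 : 0 ≤ Mf := (abs_nonneg _).trans (hMf x₀ hx₀)
  have hd : 0 < r / (2 * n) := by positivity
  have hb : ∀ k, |pd u k x| ≤ 2 * n ^ 2 * ((r ^ 2)⁻¹ * Mu + Mf) := by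
    intro k
    have := pd_bound (x := x) Metric.isOpen_ball (hu.of_le (WithTop.coe_le_coe.2 (le_top : (2 : ℕ∞) ≤ ⊤))) hd ?_ hMu hMf k
    · refine this.trans ?_
      have e1 : (n * Mu / (r / (2 * n)) ^ 2 + Mf / 2) * (r / (2 * n))
          = 2 * n ^ 2 * ((r⁻¹) * Mu) + Mf * (r / (4 * n)) := by
        field_simp
        ring
      rw [e1, mul_add]
      have e2 : r⁻¹ ≤ (r ^ 2)⁻¹ := by
        apply inv_anti₀ (by positivity)
        nlinarith
      have e3 : r / (4 * n) ≤ 2 * n ^ 2 := by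
        rw [div_le_iff₀ (by positivity)]
        have : (1:ℝ) ≤ n ^ 3 := one_le_pow₀ hn1
        nlinarith
      have e4 : Mf * (r / (4 * n)) ≤ Mf * (2 * n ^ 2) := by gcongr
      have e5 : 2 * n ^ 2 * (r⁻¹ * Mu) ≤ 2 * n ^ 2 * ((r ^ 2)⁻¹ * Mu) := by gcongr
      linarith
    · intro z hz
      have h1 : ‖z - x‖ ≤ r / 2 := by
        rw [EuclideanSpace.norm_eq]
        apply Real.sqrt_le_iff.2 ⟨by positivity, ?_⟩
        calc ∑ i, ‖(z - x) i‖ ^ 2 ≤ ∑ i : Fin n, (r / (2 * n)) ^ 2 := by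
              apply Finset.sum_le_sum
              intro i _
              have := hz i
              simp only [PiLp.sub_apply, Real.norm_eq_abs]
              gcongr
          _ = (r / 2) ^ 2 * (1 / n) := by simp; field_simp
          _ ≤ (r / 2) ^ 2 * 1 := by
              gcongr
              rw [div_le_iff₀ hn0]; linarith
          _ = _ := mul_one _
      rw [Metric.mem_ball] at hx ⊢
      rw [← dist_eq_norm] at h1
      linarith [dist_triangle z x x₀]
  set Q := 2 * n ^ 2 * ((r ^ 2)⁻¹ * Mu + Mf) with hQ
  have hQ0 : 0 ≤ Q := by positivity
  unfold gradNorm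
  rw [mul_assoc, ← hQ]
  apply Real.sqrt_le_iff.2 ⟨by positivity, ?_⟩
  calc ∑ i, pd u i x ^ 2 ≤ ∑ i : Fin n, Q ^ 2 := by
        apply Finset.sum_le_sum
        intro i _
        exact sq_le_sq.2 (by rw [abs_of_nonneg hQ0]; exact hb i)
    _ = n * Q ^ 2 := by simp
    _ ≤ (n * Q) ^ 2 := by
        have : (n:ℝ) ≤ n ^ 2 := by nlinarith
        rw [mul_pow (n:ℝ) Q 2]
        exact mul_le_mul_of_nonneg_right this (sq_nonneg Q)
end
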